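/- Let P be a simple polygon and let C be a nonredundant cut of P. Then every vertex x of Pocket(C) sees at least one point of the segment C. -/

import Mathlib

open Set

noncomputable section

/-- The Euclidean plane. -/
abbrev E2 := EuclideanSpace ℝ (Fin 2)

/-- A simple polygon in the plane, given by its cyclic sequence of vertices.
Adjacent edges meet exactly at their common vertex, and non-adjacent edges
are disjoint, so the boundary is a simple closed polygonal curve. -/
structure SimplePolygon where
  n : ℕ
  three_le : 3 ≤ n
  vtx : ZMod n → E2
  inj : Function.Injective vtx
  adj_edges : ∀ i : ZMod n,
    segment ℝ (vtx i) (vtx (i + 1)) ∩ segment ℝ (vtx (i + 1)) (vtx (i + 2)) = {vtx (i + 1)}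
  nonadj_edges : ∀ i j : ZMod n, i ≠ j → i + 1 ≠ j → j + 1 ≠ i →
    segment ℝ (vtx i) (vtx (i + 1)) ∩ segment ℝ (vtx j) (vtx (j + 1)) = ∅

namespace SimplePolygon

variable (P : SimplePolygon)

/-- The boundary `∂P`: the union of the edges. -/
def boundary : Set E2 := ⋃ i : ZMod P.n, segment ℝ (P.vtx i) (P.vtx (i + 1))

/-- The compact region bounded by `∂P`: the boundary together with all points of the
bounded connected components of its complement. -/
def region : Set E2 :=
  P.boundary ∪ {x | x ∉ P.boundary ∧ Bornology.IsBounded (connectedComponentIn P.boundaryᶜ x)}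

/-- `x` sees `y` (in `P`) if the closed segment `[x,y]` is contained in `P`. -/
def Visible (x y : E2) : Prop := segment ℝ x y ⊆ P.region

/-- The vertex `vtx i` is reflex: its internal angle is strictly larger than `π`, i.e.
near the vertex the midpoint of two points at equal small parameter along the two
incident edges lies outside the region. -/
def IsReflex (i : ZMod P.n) : Prop :=
  ∃ ε₀ > (0 : ℝ), ∀ ε ∈ Set.Ioo (0 : ℝ) ε₀,
    midpoint ℝ (P.vtx i + ε • (P.vtx (i - 1) - P.vtx i))
               (P.vtx i + ε • (P.vtx (i + 1) - P.vtx i)) ∉ P.region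

/-- `P` is star-shaped if a single point of `P` sees all of `P`. -/
def IsStarShaped : Prop := ∃ x ∈ P.region, ∀ y ∈ P.region, P.Visible x y

/-- A visibility path: a connected curve inside `P` from which every point of `P`
is visible. -/
def IsVisibilityPath (Pth : Set E2) : Prop :=
  IsConnected Pth ∧ Pth ⊆ P.region ∧ ∀ x ∈ P.region, ∃ p ∈ Pth, P.Visible x p

/-- The pocket, inside `P`, determined by a cut segment `s` on the side of the point `u`:
the closure of the connected component of `P \ s` containing `u`, together with `s`. -/
def pocketOfSeg (s : Set E2) (u : E2) : Set E2 :=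
  closure (connectedComponentIn (P.region \ s) u) ∪ s

end SimplePolygon

/-- A cut of a simple polygon `P`: for a reflex vertex `v = vtx i` with adjacent
vertex `u = vtx j`, the segment from `v` to the closest point `w` of `∂P` hit by
the ray from `v` in the direction from `u` to `v`. -/
structure SimplePolygon.Cut (P : SimplePolygon) where
  i : ZMod P.n
  j : ZMod P.n
  adj : j = i + 1 ∨ j = i - 1
  reflex : P.IsReflex i
  t : ℝ
  t_pos : 0 < t
  hits : P.vtx i + t • (P.vtx i - P.vtx j) ∈ P.boundary
  first_hit : ∀ s ∈ Set.Ioo (0 : ℝ) t, P.vtx i + s • (P.vtx i - P.vtx j) ∉ P.boundary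
  inside : segment ℝ (P.vtx i) (P.vtx i + t • (P.vtx i - P.vtx j)) ⊆ P.region

namespace SimplePolygon.Cut

variable {P : SimplePolygon} (C : P.Cut)

/-- The reflex vertex generating the cut. -/
def v : E2 := P.vtx C.i

/-- The adjacent vertex `u`; the edge `u v` is the generator of the cut. -/
def u : E2 := P.vtx C.j

/-- The other endpoint of the cut, on `∂P`. -/
def w : E2 := P.vtx C.i + C.t • (P.vtx C.i - P.vtx C.j)

/-- The cut as a segment. -/
def seg : Set E2 := segment ℝ C.v C.w

/-- `Pocket(C)`: the part of `P` cut off by `C` that contains the generator vertex `u`. -/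
def pocket : Set E2 := P.pocketOfSeg C.seg C.u

/-- A cut is redundant if the pocket of some cut is strictly contained in its pocket. -/
def Redundant : Prop := ∃ C' : P.Cut, C'.pocket ⊂ C.pocket

/-- A nonredundant (essential) cut. -/
def Nonredundant : Prop := ¬ C.Redundant

/-- `x` is a vertex of the polygon `Pocket(C)`: either the endpoint `w` of the cut, or a
vertex of `P` belonging to the pocket. -/
def PocketVertex (x : E2) : Prop :=
  x = C.w ∨ ∃ k : ZMod P.n, P.vtx k = x ∧ x ∈ C.pocket

end SimplePolygon.Cut

/-- Length of a polygonal path given by its list of vertices. -/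
def polyLength (l : List E2) : ℝ := ((l.zip l.tail).map fun p => dist p.1 p.2).sum

namespace SimplePolygon

variable (P : SimplePolygon)

/-- A polygonal path inside `P`: a nonempty list of points with each consecutive
segment contained in `P`. -/
def IsPolyPathIn (l : List E2) : Prop :=
  l ≠ [] ∧ List.Chain' (fun a b => segment ℝ a b ⊆ P.region) l

/-- `l` is a shortest Euclidean (polygonal) path inside `P` from `x` to the set `S`. -/
def IsGeodesicTo (x : E2) (S : Set E2) (l : List E2) : Prop :=
  P.IsPolyPathIn l ∧ l.head? = some x ∧ (∃ y ∈ S, l.getLast? = some y) ∧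
  ∀ m : List E2, P.IsPolyPathIn m → m.head? = some x →
    (∃ y ∈ S, m.getLast? = some y) → polyLength l ≤ polyLength m

/-- The subpolygon `Q` of `P` obtained by cutting `P` along all nonredundant cuts:
the closure of `P` minus the union of the pockets of all nonredundant cuts. -/
def core : Set E2 :=
  closure (P.region \ ⋃ C : {C : P.Cut // C.Nonredundant}, (C : P.Cut).pocket)

end SimplePolygon

/-- The planar cross product. -/
def cross2 (a b : E2) : ℝ := a 0 * b 1 - a 1 * b 0

/-- A polygonal chain all of whose turns have the sign `s` (a convex chain bending
consistently to one side). -/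
def ConvexChain (s : ℝ) (l : List E2) : Prop :=
  ∀ p q r : E2, [p, q, r] <:+: l → 0 ≤ s * cross2 (q - p) (r - q)

section PlaneGeometry

lemma cross2_add_left (a b c : E2) : cross2 (a + b) c = cross2 a c + cross2 b c := by
  simp [cross2]; ring

lemma cross2_add_right (a b c : E2) : cross2 a (b + c) = cross2 a b + cross2 a c := by
  simp [cross2]; ring

lemma cross2_smul_left (t : ℝ) (a b : E2) : cross2 (t • a) b = t * cross2 a b := by
  simp [cross2]; ring

lemma cross2_smul_right (t : ℝ) (a b : E2) : cross2 a (t • b) = t * cross2 a b := by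
  simp [cross2]; ring

lemma cross2_self (a : E2) : cross2 a a = 0 := by
  simp [cross2]; ring

lemma cross2_comm (a b : E2) : cross2 b a = -cross2 a b := by
  simp [cross2]; ring

lemma continuous_cross2_left (a : E2) : Continuous fun y => cross2 a y := by
  unfold cross2; fun_prop

/-- Cramer's rule in the plane. -/
lemma cross2_smul_eq (a b y : E2) :
    cross2 a b • y = cross2 y b • a + cross2 a y • b := by
  ext k
  fin_cases k <;> simp [cross2] <;> ring

/-- The vector `a` rotated by a right angle. -/
def rotateQuarter (a : E2) : E2 := !₂[-a 1, a 0]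

lemma cross2_rotateQuarter_pos {a : E2} (ha : a ≠ 0) : 0 < cross2 a (rotateQuarter a) := by
  have h : a 0 ≠ 0 ∨ a 1 ≠ 0 := by
    by_contra! h
    exact ha (by ext k; fin_cases k <;> simp [h.1, h.2])
  have e : cross2 a (rotateQuarter a) = a 0 * a 0 + a 1 * a 1 := by
    simp [cross2, rotateQuarter]
  rw [e]
  rcases h with h | h
  · nlinarith [mul_self_pos.2 h, mul_self_nonneg (a 1)]
  · nlinarith [mul_self_pos.2 h, mul_self_nonneg (a 0)]

lemma eq_smul_of_cross2_eq_zero {a y : E2} (ha : a ≠ 0) (h : cross2 a y = 0) :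
    ∃ t : ℝ, y = t • a := by
  have hp := cross2_rotateQuarter_pos ha
  have e := cross2_smul_eq a (rotateQuarter a) y
  rw [h, zero_smul, add_zero] at e
  refine ⟨(cross2 a (rotateQuarter a))⁻¹ * cross2 y (rotateQuarter a), ?_⟩
  rw [mul_smul, ← e, smul_smul, inv_mul_cancel₀ hp.ne', one_smul]

/-- `y` lies on the closed ray from the origin in direction `a`. -/
def OnRay (a y : E2) : Prop := ∃ t : ℝ, 0 ≤ t ∧ y = t • a

/-- Two nonzero vectors that do not point in the same direction. -/
def DistinctRays (a b : E2) : Prop := cross2 a b ≠ 0 ∨ (a ≠ 0 ∧ ∃ l < (0 : ℝ), b = l • a)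

/-- The open sector swept counterclockwise from the direction `a` to the direction `b`. -/
def Sector (a b y : E2) : Prop :=
  if 0 < cross2 a b then 0 < cross2 a y ∧ 0 < cross2 y b else 0 < cross2 a y ∨ 0 < cross2 y b

lemma DistinctRays.symm {a b : E2} (h : DistinctRays a b) : DistinctRays b a := by
  rcases h with h | ⟨ha, l, hl, rfl⟩
  · left; rw [cross2_comm]; exact neg_ne_zero.2 h
  · right
    refine ⟨smul_ne_zero hl.ne ha, l⁻¹, inv_lt_zero.2 hl, ?_⟩
    rw [smul_smul, inv_mul_cancel₀ hl.ne, one_smul]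

lemma DistinctRays.left_ne_zero {a b : E2} (h : DistinctRays a b) : a ≠ 0 := by
  rcases h with h | ⟨ha, -⟩
  · rintro rfl; exact h (by simp [cross2])
  · exact ha

lemma DistinctRays.right_ne_zero {a b : E2} (h : DistinctRays a b) : b ≠ 0 :=
  h.symm.left_ne_zero

lemma sector_of_pos {a b y : E2} (h : 0 < cross2 a b) :
    Sector a b y ↔ 0 < cross2 a y ∧ 0 < cross2 y b := by
  unfold Sector; rw [if_pos h]

lemma sector_of_nonpos {a b y : E2} (h : cross2 a b ≤ 0) :
    Sector a b y ↔ 0 < cross2 a y ∨ 0 < cross2 y b := by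
  unfold Sector; rw [if_neg h.not_gt]

lemma Sector.smul {a b y : E2} (h : Sector a b y) {t : ℝ} (ht : 0 < t) : Sector a b (t • y) := by
  unfold Sector at *
  simp only [cross2_smul_left, cross2_smul_right]
  split_ifs at * with hc
  · exact ⟨mul_pos ht h.1, mul_pos ht h.2⟩
  · exact h.imp (mul_pos ht) (mul_pos ht)

lemma onRay_of_cross2 {a b y : E2} (h : 0 < cross2 a b) (h1 : cross2 a y = 0)
    (h2 : 0 ≤ cross2 y b) : OnRay a y := by
  have e := cross2_smul_eq a b y
  rw [h1, zero_smul, add_zero] at e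
  refine ⟨(cross2 a b)⁻¹ * cross2 y b, by positivity, ?_⟩
  rw [mul_smul, ← e, smul_smul, inv_mul_cancel₀ h.ne', one_smul]

lemma onRay_of_cross2_right {a b y : E2} (h : 0 < cross2 a b) (h1 : cross2 y b = 0)
    (h2 : 0 ≤ cross2 a y) : OnRay b y := by
  have e := cross2_smul_eq a b y
  rw [h1, zero_smul, zero_add] at e
  refine ⟨(cross2 a b)⁻¹ * cross2 a y, by positivity, ?_⟩
  rw [mul_smul, ← e, smul_smul, inv_mul_cancel₀ h.ne', one_smul]

lemma onRay_or_sector_of_pos {a b : E2} (h : 0 < cross2 a b) (y : E2) :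
    OnRay a y ∨ OnRay b y ∨ Sector a b y ∨ Sector b a y := by
  rw [sector_of_pos h, sector_of_nonpos (by rw [cross2_comm]; linarith), cross2_comm y b,
    cross2_comm a y]
  rcases lt_trichotomy (cross2 a y) 0 with h1 | h1 | h1
  · right; right; right; right; linarith
  · rcases lt_or_ge (cross2 y b) 0 with h2 | h2
    · right; right; right; left; linarith
    · left; exact onRay_of_cross2 h h1 h2
  · rcases lt_trichotomy (cross2 y b) 0 with h2 | h2 | h2
    · right; right; right; left; linarith
    · right; left; exact onRay_of_cross2_right h h2 h1.le
    · right; right; left; exact ⟨h1, h2⟩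

lemma DistinctRays.onRay_or_sector {a b : E2} (h : DistinctRays a b) (y : E2) :
    OnRay a y ∨ OnRay b y ∨ Sector a b y ∨ Sector b a y := by
  rcases h with h | ⟨ha, l, hl, rfl⟩
  · rcases lt_or_gt_of_ne h with h | h
    · have h' : 0 < cross2 b a := by rw [cross2_comm]; linarith
      rcases onRay_or_sector_of_pos h' y with h | h | h | h <;> tauto
    · exact onRay_or_sector_of_pos h y
  · have e : cross2 a (l • a) = 0 := by rw [cross2_smul_right, cross2_self, mul_zero]
    have e' : cross2 (l • a) a = 0 := by rw [cross2_smul_left, cross2_self, mul_zero]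
    rw [sector_of_nonpos e.le, sector_of_nonpos e'.le]
    simp only [cross2_smul_left]
    rcases lt_trichotomy (cross2 a y) 0 with h1 | h1 | h1
    · right; right; right; left; nlinarith
    · obtain ⟨t, rfl⟩ := eq_smul_of_cross2_eq_zero ha h1
      rcases le_or_gt 0 t with ht | ht
      · left; exact ⟨t, ht, rfl⟩
      · right; left
        refine ⟨t * l⁻¹, (mul_pos_of_neg_of_neg ht (inv_lt_zero.2 hl)).le, ?_⟩
        rw [smul_smul, mul_assoc, inv_mul_cancel₀ hl.ne, mul_one]
    · right; right; left; left; exact h1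

lemma Sector.not_onRay_left {a b y : E2} (hy : Sector a b y) :
    ¬OnRay a y := by
  rintro ⟨t, ht, rfl⟩
  rcases lt_or_ge 0 (cross2 a b) with hc | hc
  · rw [sector_of_pos hc, cross2_smul_right, cross2_self] at hy
    simp at hy
  · rw [sector_of_nonpos hc, cross2_smul_right, cross2_self, cross2_smul_left] at hy
    rcases hy with hy | hy
    · simp at hy
    · nlinarith

lemma Sector.not_onRay_right {a b y : E2} (hy : Sector a b y) :
    ¬OnRay b y := by
  rintro ⟨t, ht, rfl⟩
  rcases lt_or_ge 0 (cross2 a b) with hc | hc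
  · rw [sector_of_pos hc, cross2_smul_left, cross2_self] at hy
    simp at hy
  · rw [sector_of_nonpos hc, cross2_smul_right, cross2_smul_left, cross2_self] at hy
    rcases hy with hy | hy
    · nlinarith
    · simp at hy

lemma exists_smul_norm_lt (g : E2) {ρ : ℝ} (hρ : 0 < ρ) :
    ∃ ε : ℝ, 0 < ε ∧ ∀ t : ℝ, 0 ≤ t → t ≤ ε → ‖t • g‖ < ρ := by
  refine ⟨ρ / (2 * (‖g‖ + 1)), by positivity, fun t h0 ht => ?_⟩
  rw [norm_smul, Real.norm_of_nonneg h0]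
  calc t * ‖g‖ ≤ ρ / (2 * (‖g‖ + 1)) * (‖g‖ + 1) :=
        mul_le_mul ht (by linarith) (norm_nonneg _) (by positivity)
    _ = ρ / 2 := by field_simp
    _ < ρ := by linarith

lemma convex_cross2_left_pos (a : E2) : Convex ℝ {y : E2 | 0 < cross2 a y} := by
  intro y hy z hz s t hs ht hst
  simp only [mem_ofPred_eq, cross2_add_right, cross2_smul_right] at *
  rcases hs.eq_or_lt with rfl | hs'
  · have : t = 1 := by linarith
    subst this; linarith
  · nlinarith [mul_pos hs' hy, mul_nonneg ht hz.le]

lemma convex_cross2_right_pos (a : E2) : Convex ℝ {y : E2 | 0 < cross2 y a} := by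
  have h := convex_cross2_left_pos (-a)
  have e : {y : E2 | 0 < cross2 y a} = {y : E2 | 0 < cross2 (-a) y} := by
    ext y; simp only [mem_ofPred_eq, cross2]; simp; constructor <;> intro h <;> linarith
  rwa [e]

lemma DistinctRays.exists_sector {a b : E2} (h : DistinctRays a b) :
    ∃ g, Sector a b g ∧ 0 < cross2 a g ∧ 0 < cross2 g b := by
  rcases h with h | ⟨ha, l, hl, rfl⟩
  · rcases lt_or_gt_of_ne h with h | h
    · have h1 : 0 < cross2 a ((-1 : ℝ) • (a + b)) := by
        rw [cross2_smul_right, cross2_add_right, cross2_self]; linarith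
      have h2 : 0 < cross2 ((-1 : ℝ) • (a + b)) b := by
        rw [cross2_smul_left, cross2_add_left, cross2_self]; linarith
      exact ⟨_, (sector_of_nonpos h.le).2 (Or.inl h1), h1, h2⟩
    · have h1 : 0 < cross2 a (a + b) := by rw [cross2_add_right, cross2_self]; linarith
      have h2 : 0 < cross2 (a + b) b := by rw [cross2_add_left, cross2_self]; linarith
      exact ⟨_, (sector_of_pos h).2 ⟨h1, h2⟩, h1, h2⟩
  · have h1 := cross2_rotateQuarter_pos ha
    have h2 : 0 < cross2 (rotateQuarter a) (l • a) := by
      rw [cross2_smul_right, cross2_comm a]; nlinarith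
    refine ⟨_, (sector_of_nonpos ?_).2 (Or.inl h1), h1, h2⟩
    rw [cross2_smul_right, cross2_self, mul_zero]

lemma DistinctRays.isPreconnected_sector {a b : E2} (h : DistinctRays a b) {ρ : ℝ}
    (hρ : 0 < ρ) : IsPreconnected {y : E2 | ‖y‖ < ρ ∧ Sector a b y} := by
  have hb : Convex ℝ {y : E2 | ‖y‖ < ρ} := by
    have := convex_ball (0 : E2) ρ
    simpa [Metric.ball, dist_zero_right] using this
  have ha := convex_cross2_left_pos a
  have hb' := convex_cross2_right_pos b
  rcases lt_or_ge 0 (cross2 a b) with hc | hc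
  · have e : {y : E2 | ‖y‖ < ρ ∧ Sector a b y}
        = {y : E2 | ‖y‖ < ρ} ∩ ({y : E2 | 0 < cross2 a y} ∩ {y : E2 | 0 < cross2 y b}) := by
      ext y; simp [sector_of_pos hc]
    rw [e]
    exact (hb.inter (ha.inter hb')).isPreconnected
  · have e : {y : E2 | ‖y‖ < ρ ∧ Sector a b y}
        = ({y : E2 | ‖y‖ < ρ} ∩ {y : E2 | 0 < cross2 a y})
          ∪ ({y : E2 | ‖y‖ < ρ} ∩ {y : E2 | 0 < cross2 y b}) := by
      ext y
      simp only [mem_ofPred_eq, sector_of_nonpos hc, mem_union, mem_inter_iff]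
      tauto
    obtain ⟨g, -, h1, h2⟩ := h.exists_sector
    obtain ⟨ε, hε, hg⟩ := exists_smul_norm_lt g hρ
    rw [e]
    refine IsPreconnected.union (ε • g) ⟨hg ε hε.le le_rfl, ?_⟩ ⟨hg ε hε.le le_rfl, ?_⟩
      (hb.inter ha).isPreconnected (hb.inter hb').isPreconnected
    · simp only [mem_ofPred_eq, cross2_smul_right]; positivity
    · simp only [mem_ofPred_eq, cross2_smul_left]; positivity

/-- Points of the bounding rays of a sector are limits of points of the sector. -/
lemma DistinctRays.exists_add_smul_sector {a b y : E2} (h : DistinctRays a b)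
    (hy : OnRay a y ∨ OnRay b y) : ∃ g, ∀ ε : ℝ, 0 < ε → Sector a b (y + ε • g) := by
  obtain ⟨g, -, h1, h2⟩ := h.exists_sector
  refine ⟨g, fun ε hε => ?_⟩
  have p1 := mul_pos hε h1
  have p2 := mul_pos hε h2
  rcases hy with ⟨t, ht, rfl⟩ | ⟨t, ht, rfl⟩ <;>
  rcases lt_or_ge 0 (cross2 a b) with hc | hc
  · rw [sector_of_pos hc]
    simp only [cross2_add_left, cross2_add_right, cross2_smul_left, cross2_smul_right, cross2_self]
    constructor <;> nlinarith
  · rw [sector_of_nonpos hc]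
    simp only [cross2_add_left, cross2_add_right, cross2_smul_left, cross2_smul_right, cross2_self]
    left; nlinarith
  · rw [sector_of_pos hc]
    simp only [cross2_add_left, cross2_add_right, cross2_smul_left, cross2_smul_right, cross2_self]
    constructor <;> nlinarith
  · rw [sector_of_nonpos hc]
    simp only [cross2_add_left, cross2_add_right, cross2_smul_left, cross2_smul_right, cross2_self]
    right; nlinarith

end PlaneGeometry

lemma segment_add_iff (q a : E2) {y : E2} (hy : ‖y‖ < ‖a‖) :
    q + y ∈ segment ℝ q (q + a) ↔ OnRay a y := by
  rw [segment_eq_image']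
  constructor
  · rintro ⟨t, ht, h⟩
    refine ⟨t, ht.1, ?_⟩
    simpa using h.symm
  · rintro ⟨t, ht, rfl⟩
    refine ⟨t, ⟨ht, ?_⟩, by simp⟩
    rw [norm_smul, Real.norm_of_nonneg ht] at hy
    by_contra! h
    nlinarith [norm_nonneg a]

lemma segment_add_eq_image (q a : E2) :
    segment ℝ q (q + a) = (fun t : ℝ => q + t • a) '' Icc 0 1 := by
  rw [segment_eq_image']
  simp

lemma segment_subset_union_of_mem {p q r : E2} (h : r ∈ segment ℝ p q) :
    segment ℝ p q ⊆ segment ℝ r q ∪ segment ℝ r p := by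
  rw [segment_eq_image'] at h
  obtain ⟨s, hs, rfl⟩ := h
  intro z hz
  rw [segment_eq_image'] at hz
  obtain ⟨t, ht, rfl⟩ := hz
  rcases le_total s t with hst | hst
  · left
    rw [segment_eq_image']
    rcases hs.2.eq_or_lt with rfl | h1
    · have : t = 1 := le_antisymm ht.2 hst
      exact ⟨0, ⟨le_rfl, zero_le_one⟩, by simp [this]⟩
    · have h0 : 0 < 1 - s := by linarith
      refine ⟨(t - s) / (1 - s), ⟨div_nonneg (by linarith) h0.le,
        (div_le_one h0).2 (by linarith [ht.2])⟩, ?_⟩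
      have e : (t - s) / (1 - s) * (1 - s) = t - s := div_mul_cancel₀ _ h0.ne'
      ext k
      simp only [PiLp.add_apply, PiLp.smul_apply, PiLp.sub_apply, smul_eq_mul]
      linear_combination (q k - p k) * e
  · right
    rw [segment_eq_image']
    rcases hs.1.eq_or_lt with rfl | h1
    · have : t = 0 := le_antisymm hst ht.1
      exact ⟨0, ⟨le_rfl, zero_le_one⟩, by simp [this]⟩
    · refine ⟨(s - t) / s, ⟨div_nonneg (by linarith) h1.le,
        (div_le_one h1).2 (by linarith [ht.1])⟩, ?_⟩
      have e : (s - t) / s * s = s - t := div_mul_cancel₀ _ h1.ne'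
      ext k
      simp only [PiLp.add_apply, PiLp.smul_apply, PiLp.sub_apply, smul_eq_mul]
      linear_combination (p k - q k) * e

lemma isCompact_segment (p q : E2) : IsCompact (segment ℝ p q) := by
  rw [segment_eq_image']
  exact isCompact_Icc.image (by fun_prop)

namespace SimplePolygon

variable (P : SimplePolygon)

instance : NeZero P.n := ⟨by have := P.three_le; omega⟩

lemma isCompact_boundary : IsCompact P.boundary :=
  isCompact_iUnion fun _ => isCompact_segment _ _

lemma vtx_mem_boundary (i : ZMod P.n) : P.vtx i ∈ P.boundary :=
  mem_iUnion.2 ⟨i, left_mem_segment ..⟩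

lemma segment_subset_boundary (i : ZMod P.n) :
    segment ℝ (P.vtx i) (P.vtx (i + 1)) ⊆ P.boundary :=
  subset_iUnion (fun i => segment ℝ (P.vtx i) (P.vtx (i + 1))) i

lemma one_ne_zero' : (1 : ZMod P.n) ≠ 0 := by
  have : Fact (1 < P.n) := ⟨by have := P.three_le; omega⟩
  exact one_ne_zero

lemma vtx_succ_ne (i : ZMod P.n) : P.vtx (i + 1) ≠ P.vtx i := fun h =>
  P.one_ne_zero' (by simpa using P.inj h)

lemma isPreconnected_boundary : IsPreconnected P.boundary := by
  have e : P.boundary = ⋃ k : ℕ, segment ℝ (P.vtx (k : ZMod P.n)) (P.vtx ((k : ZMod P.n) + 1)) := by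
    ext z
    simp only [boundary, mem_iUnion]
    constructor
    · rintro ⟨i, hi⟩
      exact ⟨i.val, by simpa using hi⟩
    · rintro ⟨k, hk⟩
      exact ⟨_, hk⟩
  rw [e]
  refine IsPreconnected.iUnion_of_chain (fun k => (convex_segment _ _).isPreconnected) fun k => ?_
  refine ⟨P.vtx ((k : ZMod P.n) + 1), right_mem_segment .., ?_⟩
  simp only [Order.succ_eq_add_one, Nat.cast_add, Nat.cast_one]
  exact left_mem_segment ..

lemma exists_ball_avoiding_edges (q : E2) : ∃ ρ > (0 : ℝ), ∀ k : ZMod P.n,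
    q ∉ segment ℝ (P.vtx k) (P.vtx (k + 1)) → ∀ y : E2, ‖y‖ < ρ →
      q + y ∉ segment ℝ (P.vtx k) (P.vtx (k + 1)) := by
  have hc : IsClosed (⋃ k ∈ {k : ZMod P.n | q ∉ segment ℝ (P.vtx k) (P.vtx (k + 1))},
      segment ℝ (P.vtx k) (P.vtx (k + 1))) :=
    (Set.toFinite _).isClosed_biUnion fun k _ => (isCompact_segment _ _).isClosed
  have hq : q ∈ (⋃ k ∈ {k : ZMod P.n | q ∉ segment ℝ (P.vtx k) (P.vtx (k + 1))},
      segment ℝ (P.vtx k) (P.vtx (k + 1)))ᶜ := by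
    simp
  obtain ⟨ρ, hρ, hb⟩ := Metric.isOpen_iff.1 hc.isOpen_compl q hq
  refine ⟨ρ, hρ, fun k hk y hy hmem => ?_⟩
  have := hb (show q + y ∈ Metric.ball q ρ by simpa [Metric.mem_ball, dist_eq_norm] using hy)
  exact this (mem_biUnion hk hmem)

lemma exists_local_rays_of_star {q a b : E2} (ha : a ≠ 0) (hb : b ≠ 0)
    (h : ∀ k : ZMod P.n, q ∈ segment ℝ (P.vtx k) (P.vtx (k + 1)) →
      segment ℝ (P.vtx k) (P.vtx (k + 1)) ⊆ segment ℝ q (q + a) ∪ segment ℝ q (q + b))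
    (ha' : segment ℝ q (q + a) ⊆ P.boundary) (hb' : segment ℝ q (q + b) ⊆ P.boundary) :
    ∃ ρ > (0 : ℝ), ∀ y : E2, ‖y‖ < ρ → (q + y ∈ P.boundary ↔ OnRay a y ∨ OnRay b y) := by
  obtain ⟨ρ, hρ, hk⟩ := P.exists_ball_avoiding_edges q
  refine ⟨min ρ (min ‖a‖ ‖b‖), lt_min hρ (lt_min (norm_pos_iff.2 ha) (norm_pos_iff.2 hb)),
    fun y hy => ?_⟩
  have h1 : ‖y‖ < ρ := hy.trans_le (min_le_left _ _)
  have h2 : ‖y‖ < ‖a‖ := hy.trans_le ((min_le_right _ _).trans (min_le_left _ _))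
  have h3 : ‖y‖ < ‖b‖ := hy.trans_le ((min_le_right _ _).trans (min_le_right _ _))
  rw [← segment_add_iff q a h2, ← segment_add_iff q b h3]
  constructor
  · intro hm
    obtain ⟨k, hkm⟩ := mem_iUnion.1 hm
    by_cases hq : q ∈ segment ℝ (P.vtx k) (P.vtx (k + 1))
    · exact h k hq hkm
    · exact absurd hkm (hk k hq y h1)
  · rintro (hm | hm)
    · exact ha' hm
    · exact hb' hm

lemma edge_inter_succ (i : ZMod P.n) :
    segment ℝ (P.vtx (i - 1)) (P.vtx i) ∩ segment ℝ (P.vtx i) (P.vtx (i + 1)) = {P.vtx i} := by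
  have h := P.adj_edges (i - 1)
  have e : i - 1 + 2 = i + 1 := by ring
  rwa [sub_add_cancel, e] at h

/-- Distinct edges meet only in a common endpoint. -/
lemma eq_vtx_of_mem_edges {q : E2} {k l : ZMod P.n} (hkl : k ≠ l)
    (hk : q ∈ segment ℝ (P.vtx k) (P.vtx (k + 1)))
    (hl : q ∈ segment ℝ (P.vtx l) (P.vtx (l + 1))) :
    (l = k + 1 ∧ q = P.vtx (k + 1)) ∨ (k = l + 1 ∧ q = P.vtx k) := by
  by_cases h1 : k + 1 = l
  · left
    subst h1
    have h := P.edge_inter_succ (k + 1)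
    rw [add_sub_cancel_right] at h
    exact ⟨rfl, by simpa [h] using mem_inter hk hl⟩
  by_cases h2 : l + 1 = k
  · right
    subst h2
    have h := P.edge_inter_succ (l + 1)
    rw [add_sub_cancel_right] at h
    exact ⟨rfl, by simpa [h] using mem_inter hl hk⟩
  · have h := P.nonadj_edges k l hkl h1 h2
    exact absurd (mem_inter hk hl) (by simp [h])

lemma distinctRays_vtx (i : ZMod P.n) :
    DistinctRays (P.vtx (i + 1) - P.vtx i) (P.vtx (i - 1) - P.vtx i) := by
  have ha : P.vtx (i + 1) - P.vtx i ≠ 0 := sub_ne_zero.2 (P.vtx_succ_ne i)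
  have hb : P.vtx (i - 1) - P.vtx i ≠ 0 := by
    have := P.vtx_succ_ne (i - 1)
    rw [sub_add_cancel] at this
    exact sub_ne_zero.2 this.symm
  by_cases hc : cross2 (P.vtx (i + 1) - P.vtx i) (P.vtx (i - 1) - P.vtx i) = 0
  · obtain ⟨t, ht⟩ := eq_smul_of_cross2_eq_zero ha hc
    refine Or.inr ⟨ha, t, ?_, ht⟩
    by_contra! h0
    have h0 : 0 < t := h0.lt_of_ne (by rintro rfl; exact hb (by simpa using ht))
    set s := min 1 t⁻¹ with hs
    have hs0 : 0 < s := lt_min one_pos (inv_pos.2 h0)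
    have hst : s * t ≤ 1 := by
      calc s * t ≤ t⁻¹ * t := mul_le_mul_of_nonneg_right (min_le_right _ _) h0.le
        _ = 1 := inv_mul_cancel₀ h0.ne'
    have hmem : P.vtx i + s • (P.vtx (i - 1) - P.vtx i) ∈
        segment ℝ (P.vtx (i - 1)) (P.vtx i) ∩ segment ℝ (P.vtx i) (P.vtx (i + 1)) := by
      constructor
      · rw [segment_symm, segment_eq_image']
        exact ⟨s, ⟨hs0.le, min_le_left _ _⟩, rfl⟩
      · rw [segment_eq_image']
        refine ⟨s * t, ⟨by positivity, hst⟩, ?_⟩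
        simp only [ht, smul_smul]
    rw [P.edge_inter_succ, mem_singleton_iff] at hmem
    have : s • (P.vtx (i - 1) - P.vtx i) = 0 := by simpa using hmem
    exact (smul_ne_zero hs0.ne' hb) this
  · exact Or.inl hc

/-- Near each of its points, the boundary consists of two rays. -/
lemma exists_local_rays {q : E2} (hq : q ∈ P.boundary) :
    ∃ a b : E2, DistinctRays a b ∧
      ((∃ i, q = P.vtx i ∧ a = P.vtx (i + 1) - q ∧ b = P.vtx (i - 1) - q) ∨ cross2 a b = 0) ∧
      ∃ ρ > (0 : ℝ), ∀ y : E2, ‖y‖ < ρ → (q + y ∈ P.boundary ↔ OnRay a y ∨ OnRay b y) := by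
  by_cases hv : ∃ i, q = P.vtx i
  · obtain ⟨i, rfl⟩ := hv
    have hd := P.distinctRays_vtx i
    refine ⟨_, _, hd, Or.inl ⟨i, rfl, rfl, rfl⟩,
      P.exists_local_rays_of_star hd.left_ne_zero hd.right_ne_zero (fun k hk => ?_) ?_ ?_⟩
    · simp only [add_sub_cancel]
      by_cases hki : k = i
      · subst hki; exact subset_union_left
      · rcases P.eq_vtx_of_mem_edges hki hk (left_mem_segment ..) with ⟨h, -⟩ | ⟨-, h⟩
        · subst h
          rw [add_sub_cancel_right, segment_symm]
          exact subset_union_right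
        · exact absurd (P.inj h).symm hki
    · rw [add_sub_cancel]
      exact P.segment_subset_boundary i
    · rw [add_sub_cancel, segment_symm]
      have := P.segment_subset_boundary (i - 1)
      rwa [sub_add_cancel] at this
  · push Not at hv
    obtain ⟨k, hk⟩ := mem_iUnion.1 hq
    have ha : P.vtx (k + 1) - q ≠ 0 := sub_ne_zero.2 (hv _).symm
    have hb : P.vtx k - q ≠ 0 := sub_ne_zero.2 (hv _).symm
    have hk' := hk
    rw [segment_eq_image'] at hk'
    obtain ⟨t, ht, hqt⟩ := hk'
    have ht0 : t ≠ 0 := by rintro rfl; exact hv k (by simpa using hqt.symm)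
    have ht1 : t ≠ 1 := by rintro rfl; exact hv (k + 1) (by simpa using hqt.symm)
    have h0 : 0 < t := ht.1.lt_of_ne ht0.symm
    have h1 : 0 < 1 - t := by linarith [ht.2.lt_of_ne ht1]
    have hr : P.vtx k - q = (-(t / (1 - t))) • (P.vtx (k + 1) - q) := by
      rw [← hqt]
      ext m
      simp only [PiLp.add_apply, PiLp.smul_apply, PiLp.sub_apply, smul_eq_mul]
      field_simp
      ring
    refine ⟨_, _, Or.inr ⟨ha, _, neg_lt_zero.2 (by positivity), hr⟩, Or.inr ?_,
      P.exists_local_rays_of_star ha hb (fun l hl => ?_) ?_ ?_⟩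
    · rw [hr, cross2_smul_right, cross2_self, mul_zero]
    · simp only [add_sub_cancel]
      by_cases hkl : k = l
      · subst hkl
        exact segment_subset_union_of_mem hk
      · rcases P.eq_vtx_of_mem_edges hkl hk hl with ⟨-, h⟩ | ⟨-, h⟩ <;> exact absurd h (hv _)
    · rw [add_sub_cancel]
      exact ((convex_segment _ _).segment_subset hk (right_mem_segment ..)).trans
        (P.segment_subset_boundary k)
    · rw [add_sub_cancel]
      exact ((convex_segment _ _).segment_subset hk (left_mem_segment ..)).trans
        (P.segment_subset_boundary k)

end SimplePolygon

namespace SimplePolygon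

variable (P : SimplePolygon)

/-- The points off the boundary that lie in a bounded component of its complement. -/
def inner : Set E2 :=
  {x | x ∉ P.boundary ∧ Bornology.IsBounded (connectedComponentIn P.boundaryᶜ x)}

/-- In the ball of radius `ρ` around `q`, the boundary consists of the two rays issuing from `q`
in the directions `a` and `b`. -/
structure LocalRays (q a b : E2) (ρ : ℝ) : Prop where
  distinct : DistinctRays a b
  pos : 0 < ρ
  mem_iff : ∀ y : E2, ‖y‖ < ρ → (q + y ∈ P.boundary ↔ OnRay a y ∨ OnRay b y)

variable {P}

lemma region_eq : P.region = P.boundary ∪ P.inner := rfl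

lemma boundary_subset_region : P.boundary ⊆ P.region := subset_union_left

lemma inner_subset_region : P.inner ⊆ P.region := subset_union_right

lemma isOpen_compl_boundary : IsOpen P.boundaryᶜ := P.isCompact_boundary.isClosed.isOpen_compl

lemma isOpen_component (p : E2) : IsOpen (connectedComponentIn P.boundaryᶜ p) :=
  isOpen_compl_boundary.connectedComponentIn

lemma isBounded_component_iff {p q : E2} (h : q ∈ connectedComponentIn P.boundaryᶜ p) :
    Bornology.IsBounded (connectedComponentIn P.boundaryᶜ q) ↔
      Bornology.IsBounded (connectedComponentIn P.boundaryᶜ p) := by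
  rw [connectedComponentIn_eq h]

lemma component_subset_inner {p : E2} (hp : p ∈ P.inner) :
    connectedComponentIn P.boundaryᶜ p ⊆ P.inner := fun _ hq =>
  ⟨connectedComponentIn_subset _ _ hq, (isBounded_component_iff hq).2 hp.2⟩

lemma isOpen_inner : IsOpen P.inner :=
  isOpen_iff_forall_mem_open.2 fun p hp =>
    ⟨_, component_subset_inner hp, isOpen_component p, mem_connectedComponentIn hp.1⟩

lemma notMem_region_iff {p : E2} : p ∉ P.region ↔
    p ∉ P.boundary ∧ ¬Bornology.IsBounded (connectedComponentIn P.boundaryᶜ p) := by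
  simp only [region_eq, inner, mem_union, mem_ofPred_eq]
  tauto

lemma component_subset_compl_region {p : E2} (hp : p ∉ P.region) :
    connectedComponentIn P.boundaryᶜ p ⊆ P.regionᶜ := fun _ hq => by
  rw [mem_compl_iff, notMem_region_iff]
  exact ⟨connectedComponentIn_subset _ _ hq,
    fun h => (notMem_region_iff.1 hp).2 ((isBounded_component_iff hq).1 h)⟩

lemma isClosed_region : IsClosed P.region :=
  ⟨isOpen_iff_forall_mem_open.2 fun p hp =>
    ⟨_, component_subset_compl_region hp, isOpen_component p,
      mem_connectedComponentIn (notMem_region_iff.1 hp).1⟩⟩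

lemma LocalRays.symm {q a b : E2} {ρ : ℝ} (h : P.LocalRays q a b ρ) : P.LocalRays q b a ρ :=
  ⟨h.distinct.symm, h.pos, fun y hy => (h.mem_iff y hy).trans or_comm⟩

lemma LocalRays.notMem_boundary {q a b : E2} {ρ : ℝ} (h : P.LocalRays q a b ρ) {y : E2}
    (hy : ‖y‖ < ρ) (hs : Sector a b y) : q + y ∉ P.boundary := by
  rw [h.mem_iff y hy, not_or]
  exact ⟨hs.not_onRay_left, hs.not_onRay_right⟩

lemma LocalRays.mem_component {q a b p : E2} {ρ : ℝ} (h : P.LocalRays q a b ρ) {y y' : E2}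
    (hy : ‖y‖ < ρ) (hs : Sector a b y) (hy' : ‖y'‖ < ρ) (hs' : Sector a b y')
    (hp : q + y ∈ connectedComponentIn P.boundaryᶜ p) :
    q + y' ∈ connectedComponentIn P.boundaryᶜ p := by
  have hc : IsPreconnected ((fun y => q + y) '' {y : E2 | ‖y‖ < ρ ∧ Sector a b y}) :=
    (h.distinct.isPreconnected_sector h.pos).image _ (by fun_prop)
  have hsub : (fun y => q + y) '' {y : E2 | ‖y‖ < ρ ∧ Sector a b y} ⊆ P.boundaryᶜ := by
    rintro _ ⟨z, hz, rfl⟩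
    exact h.notMem_boundary hz.1 hz.2
  rw [connectedComponentIn_eq hp]
  exact hc.subset_connectedComponentIn ⟨y, ⟨hy, hs⟩, rfl⟩ hsub ⟨y', ⟨hy', hs'⟩, rfl⟩

lemma LocalRays.exists_sector_mem {q a b : E2} {ρ : ℝ} (h : P.LocalRays q a b ρ) {V : Set E2}
    (hV : V ⊆ P.boundaryᶜ) (hq : q ∈ closure V) :
    ∃ y : E2, ‖y‖ < ρ ∧ q + y ∈ V ∧ (Sector a b y ∨ Sector b a y) := by
  obtain ⟨p, hpV, hp⟩ := Metric.mem_closure_iff.1 hq ρ h.pos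
  have hn : ‖p - q‖ < ρ := by rwa [← dist_eq_norm, dist_comm]
  refine ⟨p - q, hn, by simpa using hpV, ?_⟩
  rcases h.distinct.onRay_or_sector (p - q) with h' | h' | h' | h'
  · exact absurd ((h.mem_iff _ hn).2 (Or.inl h')) (by simpa using hV hpV)
  · exact absurd ((h.mem_iff _ hn).2 (Or.inr h')) (by simpa using hV hpV)
  · exact Or.inl h'
  · exact Or.inr h'

/-- Boundary points near `q` are limits of points of each of the two sectors at `q`. -/
lemma LocalRays.mem_closure {q a b : E2} {ρ : ℝ} (h : P.LocalRays q a b ρ) {V : Set E2}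
    (hV : ∀ y : E2, ‖y‖ < ρ → Sector a b y → q + y ∈ V) {y : E2} (hy : ‖y‖ < ρ)
    (hyb : q + y ∈ P.boundary) : q + y ∈ closure V := by
  obtain ⟨g, hg⟩ := h.distinct.exists_add_smul_sector ((h.mem_iff y hy).1 hyb)
  rw [Metric.mem_closure_iff]
  intro ε hε
  obtain ⟨δ, hδ, hδg⟩ := exists_smul_norm_lt g (lt_min hε (sub_pos.2 hy))
  have hlt := hδg δ hδ.le le_rfl
  refine ⟨q + (y + δ • g), hV _ ?_ (hg δ hδ), ?_⟩
  · calc ‖y + δ • g‖ ≤ ‖y‖ + ‖δ • g‖ := norm_add_le _ _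
      _ < ρ := by linarith [hlt.trans_le (min_le_right _ _)]
  · rw [dist_eq_norm, ← norm_neg]
    simpa using hlt.trans_le (min_le_left _ _)

lemma exists_localRays {q : E2} (hq : q ∈ P.boundary) : ∃ a b ρ, P.LocalRays q a b ρ ∧
    ((∃ i, q = P.vtx i ∧ a = P.vtx (i + 1) - q ∧ b = P.vtx (i - 1) - q) ∨ cross2 a b = 0) := by
  obtain ⟨a, b, hab, hv, ρ, hρ, h⟩ := P.exists_local_rays hq
  exact ⟨a, b, ρ, ⟨hab, hρ, h⟩, hv⟩

/-- Every boundary point is a limit of points of any given component of the complement. -/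
lemma boundary_subset_closure_component {p : E2} (hp : p ∉ P.boundary) :
    P.boundary ⊆ closure (connectedComponentIn P.boundaryᶜ p) := by
  set V := connectedComponentIn P.boundaryᶜ p with hVdef
  have hVo : IsOpen V := isOpen_component p
  have hVs : V ⊆ P.boundaryᶜ := connectedComponentIn_subset _ _
  have hne : (P.boundary ∩ closure V).Nonempty := by
    by_contra hemp
    rw [not_nonempty_iff_eq_empty] at hemp
    have hcl : closure V ⊆ P.boundaryᶜ := fun z hz hzb =>
      (eq_empty_iff_forall_notMem.1 hemp) z ⟨hzb, hz⟩
    have hVc : closure V ⊆ V :=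
      isPreconnected_connectedComponentIn.closure.subset_connectedComponentIn
        (subset_closure (mem_connectedComponentIn hp)) hcl
    have hcv : IsClosed V := closure_subset_iff_isClosed.1 hVc
    have huniv : V = univ := IsClopen.eq_univ ⟨hcv, hVo⟩ ⟨p, mem_connectedComponentIn hp⟩
    exact hVs (huniv ▸ mem_univ (P.vtx 0)) (P.vtx_mem_boundary 0)
  have hloc : ∀ q ∈ P.boundary ∩ closure V, ∃ ρ > (0 : ℝ),
      Metric.ball q ρ ∩ P.boundary ⊆ closure V := by
    rintro q ⟨hqb, hqV⟩
    obtain ⟨a, b, ρ, h, -⟩ := exists_localRays hqb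
    refine ⟨ρ, h.pos, ?_⟩
    rintro z ⟨hz, hzb⟩
    obtain ⟨y, hy, hyV, hs⟩ := h.exists_sector_mem hVs hqV
    have hzn : ‖z - q‖ < ρ := by rwa [← dist_eq_norm]
    have e : q + (z - q) = z := by abel
    rw [← e] at hzb ⊢
    rcases hs with hs | hs
    · exact h.mem_closure (fun y' hy' hs' => h.mem_component hy hs hy' hs' hyV) hzn hzb
    · exact h.symm.mem_closure (fun y' hy' hs' => h.symm.mem_component hy hs hy' hs' hyV) hzn hzb
  choose! ρ hρ hball using hloc
  by_contra hnot
  obtain ⟨z, hzb, hzV⟩ := not_subset.1 hnot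
  obtain ⟨w, hwb, hw1, hw2⟩ := P.isPreconnected_boundary
    (⋃ q ∈ P.boundary ∩ closure V, Metric.ball q (ρ q)) (closure V)ᶜ
    (isOpen_biUnion fun _ _ => Metric.isOpen_ball) isClosed_closure.isOpen_compl
    (fun q hq => by
      by_cases h : q ∈ closure V
      · exact Or.inl (mem_biUnion (x := q) ⟨hq, h⟩ (Metric.mem_ball_self (hρ q ⟨hq, h⟩)))
      · exact Or.inr h)
    (by
      obtain ⟨q, hq⟩ := hne
      exact ⟨q, hq.1, mem_biUnion hq (Metric.mem_ball_self (hρ q hq))⟩)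
    ⟨z, hzb, hzV⟩
  obtain ⟨q, hq, hwq⟩ := mem_iUnion₂.1 hw1
  exact hw2 (hball q hq ⟨hwq, hwb⟩)

/-- Distinct components of the complement of the boundary occupy distinct sectors. -/
lemma LocalRays.sector_split {q a b : E2} {ρ : ℝ} (h : P.LocalRays q a b ρ)
    (hq : q ∈ P.boundary) {p p' : E2} (hp : p ∉ P.boundary) (hp' : p' ∉ P.boundary)
    (hne : Disjoint (connectedComponentIn P.boundaryᶜ p) (connectedComponentIn P.boundaryᶜ p')) :
    (∀ y : E2, ‖y‖ < ρ → (Sector a b y → q + y ∈ connectedComponentIn P.boundaryᶜ p) ∧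
      (Sector b a y → q + y ∈ connectedComponentIn P.boundaryᶜ p')) ∨
    (∀ y : E2, ‖y‖ < ρ → (Sector b a y → q + y ∈ connectedComponentIn P.boundaryᶜ p) ∧
      (Sector a b y → q + y ∈ connectedComponentIn P.boundaryᶜ p')) := by
  obtain ⟨y, hy, hyV, hs⟩ := h.exists_sector_mem (connectedComponentIn_subset _ _)
    (boundary_subset_closure_component hp hq)
  obtain ⟨y', hy', hyV', hs'⟩ := h.exists_sector_mem (connectedComponentIn_subset _ _)
    (boundary_subset_closure_component hp' hq)
  rcases hs with hs | hs <;> rcases hs' with hs' | hs'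
  · exact absurd hyV' (hne.notMem_of_mem_left (h.mem_component hy hs hy' hs' hyV))
  · exact Or.inl fun z hz => ⟨fun hsz => h.mem_component hy hs hz hsz hyV,
      fun hsz => h.symm.mem_component hy' hs' hz hsz hyV'⟩
  · exact Or.inr fun z hz => ⟨fun hsz => h.symm.mem_component hy hs hz hsz hyV,
      fun hsz => h.mem_component hy' hs' hz hsz hyV'⟩
  · exact absurd hyV' (hne.notMem_of_mem_left (h.symm.mem_component hy hs hy' hs' hyV))

lemma disjoint_component {g u : E2} (hg : g ∈ P.inner) (hu : u ∉ P.region) :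
    Disjoint (connectedComponentIn P.boundaryᶜ g) (connectedComponentIn P.boundaryᶜ u) :=
  disjoint_left.2 fun _ h1 h2 =>
    component_subset_compl_region hu h2 (inner_subset_region (component_subset_inner hg h1))

/-- The complement of the boundary has at most two components. -/
lemma mem_component_or {g u p : E2} (hg : g ∈ P.inner) (hu : u ∉ P.region)
    (hp : p ∉ P.boundary) :
    p ∈ connectedComponentIn P.boundaryᶜ g ∨ p ∈ connectedComponentIn P.boundaryᶜ u := by
  have hq := P.vtx_mem_boundary 0
  obtain ⟨a, b, ρ, h, -⟩ := exists_localRays hq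
  obtain ⟨y, hy, hyV, hs⟩ := h.exists_sector_mem (connectedComponentIn_subset _ _)
    (boundary_subset_closure_component hp hq)
  have key : ∀ {c : E2}, P.vtx 0 + y ∈ connectedComponentIn P.boundaryᶜ c →
      p ∈ connectedComponentIn P.boundaryᶜ c := fun {c} hc => by
    rw [connectedComponentIn_eq hc, ← connectedComponentIn_eq hyV]
    exact mem_connectedComponentIn hp
  rcases h.sector_split hq hg.1 (notMem_region_iff.1 hu).1 (disjoint_component hg hu)
    with h' | h' <;>
    rcases hs with hs | hs
  · exact Or.inl (key ((h' y hy).1 hs))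
  · exact Or.inr (key ((h' y hy).2 hs))
  · exact Or.inr (key ((h' y hy).2 hs))
  · exact Or.inl (key ((h' y hy).1 hs))

lemma inner_eq_component {g u : E2} (hg : g ∈ P.inner) (hu : u ∉ P.region) :
    P.inner = connectedComponentIn P.boundaryᶜ g := by
  refine Subset.antisymm (fun p hp => ?_) (component_subset_inner hg)
  exact (mem_component_or hg hu hp.1).resolve_right fun h =>
    component_subset_compl_region hu h (inner_subset_region hp)

lemma compl_region_eq_component {g u : E2} (hg : g ∈ P.inner) (hu : u ∉ P.region) :
    P.regionᶜ = connectedComponentIn P.boundaryᶜ u := by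
  refine Subset.antisymm (fun p hp => ?_) (component_subset_compl_region hu)
  exact (mem_component_or hg hu (notMem_region_iff.1 hp).1).resolve_left fun h =>
    hp (inner_subset_region (component_subset_inner hg h))

lemma isPreconnected_inner {g u : E2} (hg : g ∈ P.inner) (hu : u ∉ P.region) :
    IsPreconnected P.inner := by
  rw [inner_eq_component hg hu]; exact isPreconnected_connectedComponentIn

lemma isPreconnected_compl_region {g u : E2} (hg : g ∈ P.inner) (hu : u ∉ P.region) :
    IsPreconnected P.regionᶜ := by
  rw [compl_region_eq_component hg hu]; exact isPreconnected_connectedComponentIn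

lemma isBounded_inner {g u : E2} (hg : g ∈ P.inner) (hu : u ∉ P.region) :
    Bornology.IsBounded P.inner := by
  rw [inner_eq_component hg hu]; exact hg.2

lemma boundary_subset_closure_compl_region {u : E2} (hu : u ∉ P.region) :
    P.boundary ⊆ closure P.regionᶜ :=
  (boundary_subset_closure_component (notMem_region_iff.1 hu).1).trans
    (closure_mono (component_subset_compl_region hu))

/-- In the ball of radius `ρ` around `q`, the boundary consists of two rays, the exterior is the
sector from `a` to `b` and the interior is the sector from `b` to `a`. -/
structure LocalSectors (P : SimplePolygon) (q a b : E2) (ρ : ℝ) : Prop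
    extends P.LocalRays q a b ρ where
  exterior : ∀ y : E2, ‖y‖ < ρ → Sector a b y → q + y ∉ P.region
  interior : ∀ y : E2, ‖y‖ < ρ → Sector b a y → q + y ∈ P.inner

lemma exists_localSectors {g u q : E2} (hg : g ∈ P.inner) (hu : u ∉ P.region)
    (hq : q ∈ P.boundary) : ∃ a b ρ, P.LocalSectors q a b ρ ∧
      ((∃ i, q = P.vtx i ∧ ((a = P.vtx (i + 1) - q ∧ b = P.vtx (i - 1) - q) ∨
        (b = P.vtx (i + 1) - q ∧ a = P.vtx (i - 1) - q))) ∨ cross2 a b = 0) := by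
  obtain ⟨a, b, ρ, h, hv⟩ := exists_localRays hq
  have hI := component_subset_inner hg
  have hE := component_subset_compl_region hu
  rcases h.sector_split hq hg.1 (notMem_region_iff.1 hu).1 (disjoint_component hg hu) with h' | h'
  · refine ⟨b, a, ρ, ⟨h.symm, fun y hy hs => hE ((h' y hy).2 hs),
      fun y hy hs => hI ((h' y hy).1 hs)⟩, ?_⟩
    rw [cross2_comm, neg_eq_zero]
    exact hv.imp_left fun ⟨i, h1, h2, h3⟩ => ⟨i, h1, Or.inr ⟨h2, h3⟩⟩
  · refine ⟨a, b, ρ, ⟨h, fun y hy hs => hE ((h' y hy).2 hs),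
      fun y hy hs => hI ((h' y hy).1 hs)⟩, ?_⟩
    exact hv.imp_left fun ⟨i, h1, h2, h3⟩ => ⟨i, h1, Or.inl ⟨h2, h3⟩⟩

lemma LocalSectors.sector_of_notMem {q a b : E2} {ρ : ℝ} (h : P.LocalSectors q a b ρ) {y : E2}
    (hy : ‖y‖ < ρ) (hq : q + y ∉ P.region) : Sector a b y := by
  rcases h.distinct.onRay_or_sector y with h' | h' | h' | h'
  · exact absurd (boundary_subset_region ((h.mem_iff y hy).2 (Or.inl h'))) hq
  · exact absurd (boundary_subset_region ((h.mem_iff y hy).2 (Or.inr h'))) hq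
  · exact h'
  · exact absurd (inner_subset_region (h.interior y hy h')) hq

/-- Near a boundary point the exterior is a cone. -/
lemma LocalSectors.smul_notMem {q a b : E2} {ρ : ℝ} (h : P.LocalSectors q a b ρ) {y : E2}
    {s t : ℝ} (hs : 0 < s) (ht : 0 < t) (hsy : ‖s • y‖ < ρ) (hty : ‖t • y‖ < ρ)
    (hq : q + s • y ∉ P.region) : q + t • y ∉ P.region := by
  have h1 := (h.sector_of_notMem hsy hq).smul (div_pos ht hs)
  rw [smul_smul, div_mul_cancel₀ _ hs.ne'] at h1
  exact h.exterior _ hty h1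

lemma LocalSectors.not_sector {q a b : E2} {ρ : ℝ} (h : P.LocalSectors q a b ρ) {y : E2}
    {s : ℝ} (hs : 0 < s) (hsy : ‖s • y‖ < ρ) (hq : q + s • y ∈ P.region) : ¬Sector a b y :=
  fun h' => h.exterior _ hsy (h'.smul hs) hq

end SimplePolygon

/-- The identification of the plane with the complex numbers. -/
def toC (z : E2) : ℂ := ⟨z 0, z 1⟩

lemma continuous_toC : Continuous toC := by
  have h : toC = fun z => ((z 0 : ℝ) : ℂ) + ((z 1 : ℝ) : ℂ) * Complex.I := by
    funext z; apply Complex.ext <;> simp [toC]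
  rw [h]; fun_prop

lemma toC_sub_ne_zero {p q : E2} (h : p ≠ q) : toC p - toC q ≠ 0 := by
  intro h'
  apply h
  have h0 := congrArg Complex.re h'
  have h1 := congrArg Complex.im h'
  simp only [toC, Complex.sub_re, Complex.sub_im, Complex.zero_re, Complex.zero_im] at h0 h1
  ext k
  fin_cases k
  · exact sub_eq_zero.1 h0
  · exact sub_eq_zero.1 h1

/-- Off the segment `[p, q]`, the quotient `(z - p) / (z - q)` avoids the branch cut of the
logarithm. -/
lemma div_mem_slitPlane {p q z : E2} (h : z ∉ segment ℝ p q) :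
    (toC z - toC p) / (toC z - toC q) ∈ Complex.slitPlane := by
  have hzp : z ≠ p := fun e => h (e ▸ left_mem_segment ℝ p q)
  have hzq : z ≠ q := fun e => h (e ▸ right_mem_segment ℝ p q)
  set w := (toC z - toC p) / (toC z - toC q) with hw
  have e : toC z - toC p = w * (toC z - toC q) := by
    rw [hw, div_mul_cancel₀ _ (toC_sub_ne_zero hzq)]
  by_contra hn
  rw [Complex.mem_slitPlane_iff, not_or, not_lt, not_not] at hn
  obtain ⟨hre, him⟩ := hn
  have h0 := congrArg Complex.re e
  have h1 := congrArg Complex.im e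
  simp only [toC, Complex.sub_re, Complex.sub_im, Complex.mul_re, Complex.mul_im, him] at h0 h1
  have hpos : 0 < 1 - w.re := by linarith
  refine h ⟨1 / (1 - w.re), -w.re / (1 - w.re), by positivity,
    div_nonneg (by linarith) hpos.le, by field_simp; ring, ?_⟩
  ext k
  fin_cases k
  · simp only [PiLp.add_apply, PiLp.smul_apply, smul_eq_mul, Fin.zero_eta]
    field_simp
    linarith
  · simp only [PiLp.add_apply, PiLp.smul_apply, smul_eq_mul, Fin.mk_one]
    field_simp
    linarith

lemma eq_of_exp_eq {S : Set E2} (hS : IsPreconnected S) {f : E2 → ℂ} (hf : ContinuousOn f S)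
    {c : ℂ} (hc : ∀ z ∈ S, Complex.exp (f z) = c) {p q : E2} (hp : p ∈ S) (hq : q ∈ S) :
    f p = f q := by
  have hmem : ∀ z ∈ S, ∃ n : ℤ, f z = f p + n * (2 * Real.pi * Complex.I) := fun z hz =>
    Complex.exp_eq_exp_iff_exists_int.1 ((hc z hz).trans (hc p hp).symm)
  set h : E2 → ℝ := fun z => (f z - f p).im / (2 * Real.pi) with hh
  have hval : ∀ z ∈ S, ∀ n : ℤ, f z = f p + n * (2 * Real.pi * Complex.I) → h z = n := by
    intro z _ n hn
    simp only [hh, hn, add_sub_cancel_left]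
    have : ((n : ℂ) * (2 * Real.pi * Complex.I)).im = n * (2 * Real.pi) := by simp
    rw [this]; field_simp
  have hcont : ContinuousOn h S :=
    (Complex.continuous_im.comp_continuousOn (hf.sub continuousOn_const)).div_const _
  obtain ⟨n, hn⟩ := hmem q hq
  have hconst : h q = h p := by
    refine hS.constant_of_mapsTo (T := range ((↑) : ℤ → ℝ)) ?_ hcont ?_ hq hp
    · exact Int.isClosedEmbedding_coe_real.isEmbedding.isDiscrete_range
    · intro z hz
      obtain ⟨m, hm⟩ := hmem z hz
      exact ⟨m, (hval z hz m hm).symm⟩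
  have hpz : h p = 0 := by simp [hh]
  have hn0 : n = 0 := by
    have := hval q hq n hn
    rw [hconst, hpz] at this
    exact_mod_cast this.symm
  rw [hn, hn0]; simp

lemma log_sub_log_neg_of_im_pos {w : ℂ} (h : 0 < w.im) :
    (Complex.log w - Complex.log (-w)).im = Real.pi := by
  rw [Complex.sub_im, Complex.log_im, Complex.log_im, Complex.arg_neg_eq_arg_sub_pi_of_im_pos h]
  ring

lemma log_sub_log_neg_of_im_neg {w : ℂ} (h : w.im < 0) :
    (Complex.log w - Complex.log (-w)).im = -Real.pi := by
  rw [Complex.sub_im, Complex.log_im, Complex.log_im, Complex.arg_neg_eq_arg_add_pi_of_im_neg h]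
  ring

lemma im_div_eq (r δ z : E2) (T : ℝ) :
    ((toC z - toC r) / (toC z - toC (r + T • δ))).im =
      -T * cross2 δ (z - r) / Complex.normSq (toC z - toC (r + T • δ)) := by
  rw [Complex.div_im]
  simp only [toC, Complex.sub_re, Complex.sub_im, PiLp.add_apply, PiLp.smul_apply, smul_eq_mul,
    cross2, PiLp.sub_apply]
  ring

namespace SimplePolygon

variable {P : SimplePolygon}

lemma exists_log {u u' : E2} (hU : IsPreconnected P.regionᶜ) (hu : u ∈ P.regionᶜ)
    (hu' : u' ∈ P.regionᶜ) : ∃ L : E2 → ℂ, ContinuousOn L P.region ∧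
      ∀ z ∈ P.region, Complex.exp (L z) = (toC z - toC u) / (toC z - toC u') := by
  have hne : ∀ z ∈ P.region, ∀ y ∈ P.regionᶜ, toC z - toC y ≠ 0 := fun z hz y hy =>
    toC_sub_ne_zero fun e => hy (e ▸ hz)
  refine hU.induction₂ (fun u u' => ∃ L : E2 → ℂ, ContinuousOn L P.region ∧
      ∀ z ∈ P.region, Complex.exp (L z) = (toC z - toC u) / (toC z - toC u')) ?_ ?_ ?_ hu hu'
  · intro y hy
    obtain ⟨ε, hε, hb⟩ := Metric.isOpen_iff.1 isClosed_region.isOpen_compl y hy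
    filter_upwards [mem_nhdsWithin_of_mem_nhds (Metric.ball_mem_nhds y hε)] with y' hy'
    have hseg : ∀ z ∈ P.region, z ∉ segment ℝ y y' := fun z hz hzs =>
      hb ((convex_ball y ε).segment_subset (Metric.mem_ball_self hε) hy' hzs) hz
    refine ⟨fun z => Complex.log ((toC z - toC y) / (toC z - toC y')), ?_, fun z hz => ?_⟩
    · refine ContinuousOn.clog (ContinuousOn.div ?_ ?_ fun z hz => hne z hz y' (hb hy'))
        fun z hz => div_mem_slitPlane (hseg z hz)
      · exact (continuous_toC.sub continuous_const).continuousOn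
      · exact (continuous_toC.sub continuous_const).continuousOn
    · exact Complex.exp_log (Complex.slitPlane_ne_zero (div_mem_slitPlane (hseg z hz)))
  · rintro a b c - hb - ⟨L, hL, hLe⟩ ⟨M, hM, hMe⟩
    refine ⟨fun z => L z + M z, hL.add hM, fun z hz => ?_⟩
    rw [Complex.exp_add, hLe z hz, hMe z hz, div_mul_div_cancel₀ (hne z hz b hb)]
  · rintro a b - - ⟨L, hL, hLe⟩
    refine ⟨fun z => -L z, hL.neg, fun z hz => ?_⟩
    rw [Complex.exp_neg, hLe z hz, inv_div]

/-- A boundary point can be reached by a segment from outside the region. -/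
lemma exists_exterior_segment {g u q : E2} (hg : g ∈ P.inner) (hu : u ∉ P.region)
    (hq : q ∈ P.boundary) : ∃ p, p ∉ P.region ∧ segment ℝ p q ∩ P.region ⊆ {q} := by
  obtain ⟨a, b, ρ, h, -⟩ := exists_localSectors hg hu hq
  obtain ⟨y, hy, -⟩ := h.distinct.exists_sector
  obtain ⟨ε, hε, hb⟩ := exists_smul_norm_lt y h.pos
  refine ⟨q + ε • y, h.exterior _ (hb ε hε.le le_rfl) (hy.smul hε), ?_⟩
  rintro z ⟨hz, hzP⟩
  rw [segment_symm, segment_add_eq_image] at hz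
  obtain ⟨t, ⟨ht0, ht1⟩, rfl⟩ := hz
  rcases ht0.eq_or_lt with rfl | ht
  · simp
  · refine absurd hzP ?_
    simp only [smul_smul]
    exact h.exterior _ (hb _ (by positivity) (mul_le_of_le_one_left hε.le ht1))
      (hy.smul (by positivity))

/-- A chord separates the points close to it on one side from those on the other side. -/
lemma chord_separates {g u r δ : E2} {T t : ℝ} (hg : g ∈ P.inner) (hu : u ∉ P.region)
    (hr : r ∈ P.boundary) (hω : r + T • δ ∈ P.boundary)
    (hin : ∀ s, 0 < s → s < T → r + s • δ ∈ P.inner) (ht : 0 < t) (htT : t < T) :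
    ∃ ε > 0, Metric.ball (r + t • δ) ε ⊆ P.inner ∧ ∀ p₁ ∈ Metric.ball (r + t • δ) ε,
      ∀ p₂ ∈ Metric.ball (r + t • δ) ε, cross2 δ (p₁ - r) * cross2 δ (p₂ - r) < 0 →
      ∀ S : Set E2, IsPreconnected S → S ⊆ P.region \ segment ℝ r (r + T • δ) →
        p₁ ∈ S → p₂ ∉ S := by
  have hT : 0 < T := ht.trans htT
  set ω := r + T • δ with hωdef
  set m := r + t • δ with hm
  have hmI : m ∈ P.inner := hin t ht htT
  obtain ⟨ur, hur, hurs⟩ := exists_exterior_segment hg hu hr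
  obtain ⟨uω, huω, huωs⟩ := exists_exterior_segment hg hu hω
  obtain ⟨L, hL, hLe⟩ := exists_log (isPreconnected_compl_region hg hu) hur huω
  have hne : ∀ z q : E2, z ≠ q → toC z - toC q ≠ 0 := fun z q => toC_sub_ne_zero
  set w₁ : E2 → ℂ := fun z => (toC z - toC ur) / (toC z - toC r) with hw₁
  set w₂ : E2 → ℂ := fun z => (toC z - toC r) / (toC z - toC ω) with hw₂
  set w₃ : E2 → ℂ := fun z => (toC z - toC ω) / (toC z - toC uω) with hw₃
  have hcsub : ∀ (q : E2) (A : Set E2), ContinuousOn (fun z => toC z - toC q) A := fun q A =>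
    (continuous_toC.sub continuous_const).continuousOn
  have hs₁ : ∀ z ∈ P.region, z ≠ r → w₁ z ∈ Complex.slitPlane := fun z hz hzr =>
    div_mem_slitPlane fun h => hzr (hurs ⟨h, hz⟩)
  have hs₃ : ∀ z ∈ P.region, z ≠ ω → w₃ z ∈ Complex.slitPlane := fun z hz hzω =>
    div_mem_slitPlane fun h => hzω (huωs ⟨segment_symm ℝ ω uω ▸ h, hz⟩)
  have hprod : ∀ z ∈ P.region, z ≠ r → z ≠ ω →
      w₁ z * w₂ z * w₃ z = Complex.exp (L z) := fun z hz hzr hzω => by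
    have huz : z ≠ uω := fun e => huω (e ▸ hz)
    rw [hLe z hz, hw₁, hw₂, hw₃]
    have := hne z r hzr; have := hne z ω hzω; have := hne z uω huz
    field_simp
  have hc₁ : ∀ A ⊆ P.region, r ∉ A → ContinuousOn (fun z => Complex.log (w₁ z)) A :=
    fun A hA hrA => ContinuousOn.clog ((hcsub ur A).div (hcsub r A)
      fun z hz => hne z r fun e => hrA (e ▸ hz)) fun z hz => hs₁ z (hA hz) fun e => hrA (e ▸ hz)
  have hc₃ : ∀ A ⊆ P.region, ω ∉ A → ContinuousOn (fun z => Complex.log (w₃ z)) A :=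
    fun A hA hωA => ContinuousOn.clog ((hcsub ω A).div (hcsub uω A)
      fun z hz => hne z uω fun e => huω (e ▸ hA hz))
      fun z hz => hs₃ z (hA hz) fun e => hωA (e ▸ hz)
  have hcw₂ : ∀ A : Set E2, ω ∉ A → ContinuousOn w₂ A := fun A hωA =>
    (hcsub r A).div (hcsub ω A) fun z hz => hne z ω fun e => hωA (e ▸ hz)
  have hwm : -w₂ m ∈ Complex.slitPlane := by
    have hmω : m ≠ ω := fun e => hmI.1 (e ▸ hω)
    have e : w₂ m = ((-(t / (T - t)) : ℝ) : ℂ) := by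
      rw [hw₂]
      simp only
      rw [div_eq_iff (hne m ω hmω)]
      have h0 : T - t ≠ 0 := by linarith
      apply Complex.ext
      · simp only [toC, hm, hωdef, Complex.sub_re, Complex.re_ofReal_mul,
          PiLp.add_apply, PiLp.smul_apply, smul_eq_mul]
        field_simp; ring
      · simp only [toC, hm, hωdef, Complex.sub_im, Complex.im_ofReal_mul,
          PiLp.add_apply, PiLp.smul_apply, smul_eq_mul]
        field_simp; ring
    rw [e, ← Complex.ofReal_neg, neg_neg, Complex.ofReal_mem_slitPlane]
    exact div_pos ht (by linarith)
  have hnear : ∀ᶠ z in nhds m, z ∈ P.inner ∧ -w₂ z ∈ Complex.slitPlane := by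
    refine Filter.Eventually.and (isOpen_inner.mem_nhds hmI) ?_
    have hca : ContinuousAt w₂ m := (hcw₂ P.inner fun h => h.1 hω).continuousAt
      (isOpen_inner.mem_nhds hmI)
    exact hca.neg.eventually (Complex.isOpen_slitPlane.mem_nhds hwm)
  obtain ⟨ε, hε, hball⟩ := Metric.eventually_nhds_iff_ball.1 hnear
  refine ⟨ε, hε, fun z hz => (hball z hz).1, ?_⟩
  intro p₁ hp₁ p₂ hp₂ hcr S hS hSs hp₁S hp₂S
  have hSr : S ⊆ P.region := fun z hz => (hSs hz).1
  have hrS : r ∉ S := fun h => (hSs h).2 (left_mem_segment ℝ _ _)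
  have hωS : ω ∉ S := fun h => (hSs h).2 (right_mem_segment ℝ _ _)
  have hBr : Metric.ball m ε ⊆ P.region := fun z hz => inner_subset_region (hball z hz).1
  have hrB : r ∉ Metric.ball m ε := fun h => (hball r h).1.1 hr
  have hωB : ω ∉ Metric.ball m ε := fun h => (hball ω h).1.1 hω
  have hs₂ : ∀ z ∈ S, w₂ z ∈ Complex.slitPlane := fun z hz => div_mem_slitPlane (hSs hz).2
  have hF : Complex.log (w₁ p₁) + Complex.log (w₂ p₁) + Complex.log (w₃ p₁) - L p₁ =
      Complex.log (w₁ p₂) + Complex.log (w₂ p₂) + Complex.log (w₃ p₂) - L p₂ := by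
    refine eq_of_exp_eq hS (f := fun z => Complex.log (w₁ z) + Complex.log (w₂ z) +
      Complex.log (w₃ z) - L z) (c := 1) ?_ (fun z hz => ?_) hp₁S hp₂S
    · exact (((hc₁ S hSr hrS).add ((hcw₂ S hωS).clog hs₂)).add (hc₃ S hSr hωS)).sub (hL.mono hSr)
    · have hzr : z ≠ r := fun e => hrS (e ▸ hz)
      have hzω : z ≠ ω := fun e => hωS (e ▸ hz)
      rw [Complex.exp_sub, Complex.exp_add, Complex.exp_add,
        Complex.exp_log (Complex.slitPlane_ne_zero (hs₁ z (hSr hz) hzr)),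
        Complex.exp_log (Complex.slitPlane_ne_zero (hs₂ z hz)),
        Complex.exp_log (Complex.slitPlane_ne_zero (hs₃ z (hSr hz) hzω)),
        hprod z (hSr hz) hzr hzω, div_self (Complex.exp_ne_zero _)]
  have hH : Complex.log (w₁ p₁) + Complex.log (-w₂ p₁) + Complex.log (w₃ p₁) - L p₁ =
      Complex.log (w₁ p₂) + Complex.log (-w₂ p₂) + Complex.log (w₃ p₂) - L p₂ := by
    refine eq_of_exp_eq (convex_ball m ε).isPreconnected (f := fun z => Complex.log (w₁ z) +
      Complex.log (-w₂ z) + Complex.log (w₃ z) - L z) (c := -1) ?_ (fun z hz => ?_) hp₁ hp₂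
    · exact (((hc₁ _ hBr hrB).add ((hcw₂ _ hωB).neg.clog fun z hz => (hball z hz).2)).add
        (hc₃ _ hBr hωB)).sub (hL.mono hBr)
    · have hzr : z ≠ r := fun e => hrB (e ▸ hz)
      have hzω : z ≠ ω := fun e => hωB (e ▸ hz)
      rw [Complex.exp_sub, Complex.exp_add, Complex.exp_add,
        Complex.exp_log (Complex.slitPlane_ne_zero (hs₁ z (hBr hz) hzr)),
        Complex.exp_log (Complex.slitPlane_ne_zero (hball z hz).2),
        Complex.exp_log (Complex.slitPlane_ne_zero (hs₃ z (hBr hz) hzω)),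
        mul_neg, neg_mul, hprod z (hBr hz) hzr hzω, neg_div, div_self (Complex.exp_ne_zero _)]
  have hdiff : Complex.log (w₂ p₁) - Complex.log (-w₂ p₁) =
      Complex.log (w₂ p₂) - Complex.log (-w₂ p₂) := by linear_combination hF - hH
  have hdiff' := congrArg Complex.im hdiff
  have him : ∀ z ∈ Metric.ball m ε, ∃ k > 0, (w₂ z).im = -k * cross2 δ (z - r) := by
    intro z hz
    have hn : 0 < Complex.normSq (toC z - toC ω) :=
      Complex.normSq_pos.2 (hne z ω fun e => hωB (e ▸ hz))
    refine ⟨T / Complex.normSq (toC z - toC ω), by positivity, ?_⟩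
    rw [hw₂]
    simp only
    rw [hωdef, im_div_eq]; ring
  obtain ⟨k₁, hk₁, e₁⟩ := him p₁ hp₁
  obtain ⟨k₂, hk₂, e₂⟩ := him p₂ hp₂
  have hpi := Real.pi_pos
  rcases mul_neg_iff.1 hcr with ⟨h1, h2⟩ | ⟨h1, h2⟩
  · rw [log_sub_log_neg_of_im_neg (by rw [e₁]; nlinarith),
      log_sub_log_neg_of_im_pos (by rw [e₂]; nlinarith)] at hdiff'
    linarith
  · rw [log_sub_log_neg_of_im_pos (by rw [e₁]; nlinarith),
      log_sub_log_neg_of_im_neg (by rw [e₂]; nlinarith)] at hdiff'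
    linarith

end SimplePolygon

lemma cross2_neg_left (a b : E2) : cross2 (-a) b = -cross2 a b := by
  simp [cross2]; ring

lemma cross2_neg_right (a b : E2) : cross2 a (-b) = -cross2 a b := by
  simp [cross2]; ring

lemma mem_segment_add_smul_iff {r δ z : E2} {T : ℝ} (hT : 0 < T) :
    z ∈ segment ℝ r (r + T • δ) ↔ ∃ s, 0 ≤ s ∧ s ≤ T ∧ z = r + s • δ := by
  rw [segment_add_eq_image]
  constructor
  · rintro ⟨t, ⟨h0, h1⟩, rfl⟩
    exact ⟨t * T, by positivity, mul_le_of_le_one_left hT.le h1, by simp only [smul_smul]⟩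
  · rintro ⟨s, h0, h1, rfl⟩
    refine ⟨s / T, ⟨by positivity, (div_le_one hT).2 h1⟩, ?_⟩
    simp only [smul_smul]
    rw [div_mul_cancel₀ _ hT.ne']

lemma mem_connectedComponentIn_of_mem_closure {F : Set E2} {p q : E2}
    (hq : q ∈ closure (connectedComponentIn F p)) (hqF : q ∈ F) :
    q ∈ connectedComponentIn F p := by
  obtain ⟨y, hy⟩ := closure_nonempty_iff.1 ⟨q, hq⟩
  have hpre : IsPreconnected (insert q (connectedComponentIn F p)) :=
    isPreconnected_connectedComponentIn.subset_closure (subset_insert _ _)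
      (insert_subset hq subset_closure)
  rw [connectedComponentIn_eq hy] at hpre ⊢
  exact hpre.subset_connectedComponentIn (mem_insert_of_mem _ (connectedComponentIn_eq hy ▸ hy))
    (insert_subset hqF (connectedComponentIn_subset _ _)) (mem_insert _ _)

lemma mem_closure_of_add_smul_mem {V : Set E2} {p y : E2} {η₀ : ℝ} (hη₀ : 0 < η₀)
    (h : ∀ η, 0 < η → η ≤ η₀ → p + η • y ∈ V) : p ∈ closure V := by
  rw [Metric.mem_closure_iff]
  intro ε hε
  obtain ⟨δ, hδ, hδy⟩ := exists_smul_norm_lt y hε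
  refine ⟨p + min δ η₀ • y, h _ (lt_min hδ hη₀) (min_le_right _ _), ?_⟩
  rw [dist_self_add_right]
  exact hδy _ (lt_min hδ hη₀).le (min_le_left _ _)

lemma mul_cross2_eq (a b d y : E2) :
    cross2 a b * cross2 d y = cross2 y b * cross2 d a + cross2 a y * cross2 d b := by
  simp only [cross2]; ring

lemma isOpen_cross2_pos (σ : ℝ) (d x : E2) : IsOpen {q : E2 | 0 < σ * cross2 d (q - x)} :=
  isOpen_lt continuous_const
    (continuous_const.mul ((continuous_cross2_left d).comp (continuous_id.sub continuous_const)))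

lemma convex_cross2_pos (σ : ℝ) (d x : E2) : Convex ℝ {q : E2 | 0 < σ * cross2 d (q - x)} := by
  have h := (convex_cross2_left_pos (σ • d)).translate_preimage_left (-x)
  have e : {q : E2 | 0 < σ * cross2 d (q - x)} =
      (fun q => q + -x) ⁻¹' {y : E2 | 0 < cross2 (σ • d) y} := by
    ext q
    simp only [mem_preimage, mem_ofPred_eq, cross2_smul_left, sub_eq_add_neg]
  rwa [e]

namespace SimplePolygon

variable {P : SimplePolygon}

lemma chord_subset_region {r δ : E2} {T : ℝ} (hT : 0 < T) (hr : r ∈ P.boundary)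
    (hω : r + T • δ ∈ P.boundary) (hin : ∀ s, 0 < s → s < T → r + s • δ ∈ P.inner) :
    segment ℝ r (r + T • δ) ⊆ P.region := by
  intro z hz
  obtain ⟨s, h0, h1, rfl⟩ := (mem_segment_add_smul_iff hT).1 hz
  rcases h0.eq_or_lt with rfl | h0
  · simpa using boundary_subset_region hr
  rcases h1.eq_or_lt with rfl | h1
  · exact boundary_subset_region hω
  · exact inner_subset_region (hin s h0 h1)

/-- A ray that starts into the interior runs inside until it first hits the boundary. -/
lemma exists_first_hit {r δ : E2} {ε : ℝ} (hb : Bornology.IsBounded P.inner) (hδ : δ ≠ 0)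
    (hε : 0 < ε) (h : ∀ s, 0 < s → s ≤ ε → r + s • δ ∈ P.inner) :
    ∃ T > (0 : ℝ), r + T • δ ∈ P.boundary ∧ ∀ s, 0 < s → s < T → r + s • δ ∈ P.inner := by
  have hcont : Continuous fun s : ℝ => r + s • δ := by fun_prop
  set A : Set ℝ := {s | ε ≤ s ∧ r + s • δ ∉ P.inner} with hA
  have hAc : IsClosed A := by
    have : A = Ici ε ∩ (fun s : ℝ => r + s • δ) ⁻¹' P.innerᶜ := rfl
    rw [this]
    exact isClosed_Ici.inter (isOpen_inner.isClosed_compl.preimage hcont)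
  have hAne : A.Nonempty := by
    obtain ⟨R, hR⟩ := hb.exists_norm_le
    have hδ' : 0 < ‖δ‖ := norm_pos_iff.2 hδ
    refine ⟨max ε ((|R| + ‖r‖ + 1) / ‖δ‖), le_max_left _ _, fun hin => ?_⟩
    have h1 := hR _ hin
    set s := max ε ((|R| + ‖r‖ + 1) / ‖δ‖)
    have hs : 0 < s := hε.trans_le (le_max_left _ _)
    have h2 : |R| + ‖r‖ + 1 ≤ s * ‖δ‖ := (div_le_iff₀ hδ').1 (le_max_right _ _)
    have h3 : ‖s • δ‖ ≤ ‖r + s • δ‖ + ‖r‖ := by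
      simpa using norm_sub_le (r + s • δ) r
    rw [norm_smul, Real.norm_of_nonneg hs.le] at h3
    have := le_abs_self R
    linarith
  have hAb : BddBelow A := ⟨ε, fun s hs => hs.1⟩
  have hTA := hAc.csInf_mem hAne hAb
  set T := sInf A
  have hT : 0 < T := hε.trans_le hTA.1
  have hin : ∀ s, 0 < s → s < T → r + s • δ ∈ P.inner := by
    intro s h0 h1
    rcases le_or_gt s ε with h2 | h2
    · exact h s h0 h2
    · by_contra h3
      exact (notMem_of_lt_csInf h1 hAb) ⟨h2.le, h3⟩
  refine ⟨T, hT, ?_, hin⟩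
  have hcl : r + T • δ ∈ closure P.inner := by
    have : T ∈ closure (Ioo 0 T) := by rw [closure_Ioo hT.ne]; exact right_mem_Icc.2 hT.le
    exact map_mem_closure (f := fun s : ℝ => r + s • δ) hcont this fun s hs => hin s hs.1 hs.2
  have hreg : r + T • δ ∈ P.region :=
    closure_minimal inner_subset_region isClosed_region hcl
  rw [region_eq] at hreg
  exact hreg.resolve_right hTA.2

/-- Near `r`, the exterior is a convex cone spanned by `e` and `f`, which are in the orientation
`σ`. -/
structure Corner (P : SimplePolygon) (σ : ℝ) (r e f : E2) (ρ : ℝ) : Prop where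
  sign : σ = 1 ∨ σ = -1
  pos : 0 < ρ
  turn : 0 < σ * cross2 e f
  exterior : ∀ y : E2, ‖y‖ < ρ → 0 < σ * cross2 e y → 0 < σ * cross2 y f → r + y ∉ P.region
  interior : ∀ y : E2, ‖y‖ < ρ → (σ * cross2 e y < 0 ∨ σ * cross2 y f < 0) → r + y ∈ P.inner

lemma LocalSectors.corner {r a b : E2} {ρ : ℝ} (h : P.LocalSectors r a b ρ)
    (hab : 0 < cross2 a b) : P.Corner 1 r a b ρ ∧ P.Corner (-1) r b a ρ := by
  have hba : cross2 b a ≤ 0 := by rw [cross2_comm]; linarith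
  have hext := h.exterior
  have hint := h.interior
  simp only [sector_of_pos hab, sector_of_nonpos hba] at hext hint
  refine ⟨⟨Or.inl rfl, h.pos, by linarith, fun y hy h1 h2 => ?_, fun y hy h1 => ?_⟩,
    ⟨Or.inr rfl, h.pos, by rw [cross2_comm]; linarith, fun y hy h1 h2 => ?_, fun y hy h1 => ?_⟩⟩
  · exact hext y hy ⟨by linarith, by linarith⟩
  · rw [cross2_comm y a, cross2_comm b y] at h1
    exact hint y hy (h1.symm.imp (fun h => by linarith) fun h => by linarith)
  · rw [cross2_comm y b, cross2_comm a y] at *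
    exact hext y hy ⟨by linarith, by linarith⟩
  · exact hint y hy (h1.imp (fun h => by linarith) fun h => by linarith)

lemma Corner.isReflex {σ ρ : ℝ} {i : ZMod P.n} {e f : E2} (h : P.Corner σ (P.vtx i) e f ρ)
    (hef : e + f = (P.vtx (i - 1) - P.vtx i) + (P.vtx (i + 1) - P.vtx i)) : P.IsReflex i := by
  obtain ⟨ε, hε, hb⟩ := exists_smul_norm_lt (e + f) h.pos
  refine ⟨ε, hε, fun t ht => ?_⟩
  have e1 : midpoint ℝ (P.vtx i + t • (P.vtx (i - 1) - P.vtx i))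
      (P.vtx i + t • (P.vtx (i + 1) - P.vtx i)) = P.vtx i + (t / 2) • (e + f) := by
    rw [midpoint_eq_smul_add, hef, invOf_eq_inv]
    module
  rw [e1]
  have ht2 : 0 < t / 2 := half_pos ht.1
  have := mul_pos ht2 h.turn
  refine h.exterior _ (hb _ ht2.le (by linarith [ht.1, ht.2])) ?_ ?_
  · rw [cross2_smul_right, cross2_add_right, cross2_self]; linarith
  · rw [cross2_smul_left, cross2_add_left, cross2_self]; linarith

/-- Points on the far side of a line supporting the exterior cone are interior. -/
lemma Corner.interior_of_supporting {σ ρ : ℝ} {r e f d y : E2} (h : P.Corner σ r e f ρ)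
    (he : 0 ≤ σ * cross2 d e) (hf : 0 ≤ σ * cross2 d f) (hy : ‖y‖ < ρ)
    (hdy : σ * cross2 d y < 0) : r + y ∈ P.inner := by
  refine h.interior y hy ?_
  by_contra! hc
  have e1 := mul_cross2_eq e f d y
  have h1 := mul_nonneg hc.2 he
  have h2 := mul_nonneg hc.1 hf
  have h3 := mul_pos h.turn (neg_pos.2 hdy)
  have e2 : (σ * cross2 e f) * (σ * cross2 d y) = (σ * cross2 y f) * (σ * cross2 d e) +
    (σ * cross2 e y) * (σ * cross2 d f) := by linear_combination σ * σ * e1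
  linarith

end SimplePolygon

namespace SimplePolygon

variable {P : SimplePolygon}

/-- If `x` sees `z` but, on the side `σ` of the line `xz`, points arbitrarily close to `z` are
hidden from `x`, then the segment `xz` touches the exterior on that side; at the last point
`x + τ • d` of contact, the boundary has a reflex vertex. -/
lemma exists_corner {g u x d : E2} {σ : ℝ} (hg : g ∈ P.inner) (hu : u ∉ P.region)
    (hx : x ∈ P.boundary) (hσ : σ = 1 ∨ σ = -1) (hz : x + d ∈ P.inner)
    (hvis : segment ℝ x (x + d) ⊆ P.region)
    (hside : ∀ ε > 0, ∃ z', dist z' (x + d) < ε ∧ 0 < σ * cross2 d (z' - x) ∧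
      ¬segment ℝ x z' ⊆ P.region) :
    ∃ (τ : ℝ) (i j : ZMod P.n) (e : E2) (ρ : ℝ), 0 < τ ∧ τ < 1 ∧ x + τ • d = P.vtx i ∧
      (j = i + 1 ∨ j = i - 1) ∧ P.Corner σ (P.vtx i) e (P.vtx j - P.vtx i) ρ ∧ P.IsReflex i ∧
      0 < σ * cross2 d e ∧ 0 ≤ σ * cross2 d (P.vtx j - P.vtx i) ∧
      ∀ t, τ < t → t ≤ 1 →
        x + t • d ∉ closure (P.regionᶜ ∩ {q | 0 < σ * cross2 d (q - x)}) := by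
  set V : Set E2 := P.regionᶜ ∩ {q | 0 < σ * cross2 d (q - x)} with hV
  have hVinner : ∀ q ∈ P.inner, q ∉ closure V := fun q hq hqV => by
    obtain ⟨p, hpI, hpV⟩ := mem_closure_iff.1 hqV _ isOpen_inner hq
    exact hpV.1 (inner_subset_region hpI)
  have hd : d ≠ 0 := by
    rintro rfl
    rw [add_zero] at hz
    exact hz.1 hx
  have hvis' : ∀ t : ℝ, 0 ≤ t → t ≤ 1 → x + t • d ∈ P.region := fun t h0 h1 =>
    hvis (by rw [segment_add_eq_image]; exact ⟨t, ⟨h0, h1⟩, rfl⟩)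
  obtain ⟨a₀, b₀, ρ₀, hloc₀, -⟩ := exists_localSectors hg hu hx
  obtain ⟨t₁, ht₁, ht₁1, hnorm⟩ : ∃ t₁ : ℝ, 0 < t₁ ∧ t₁ ≤ 1 ∧
      ∀ (t : ℝ) (y : E2), 0 ≤ t → t ≤ t₁ → ‖y‖ ≤ ‖d‖ + 1 → ‖t • y‖ < ρ₀ := by
    have hρ₀ := hloc₀.pos
    refine ⟨min 1 (ρ₀ / (2 * (‖d‖ + 1))), lt_min one_pos (by positivity), min_le_left _ _,
      fun t y h0 h1 hy => ?_⟩
    rw [norm_smul, Real.norm_of_nonneg h0]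
    calc t * ‖y‖ ≤ ρ₀ / (2 * (‖d‖ + 1)) * (‖d‖ + 1) :=
          mul_le_mul (h1.trans (min_le_right _ _)) hy (norm_nonneg _) (by positivity)
      _ = ρ₀ / 2 := by field_simp
      _ < ρ₀ := half_lt_self hρ₀
  have hcont : Continuous fun t : ℝ => x + t • d := by fun_prop
  set A : Set ℝ := Icc t₁ 1 ∩ (fun t : ℝ => x + t • d) ⁻¹' closure V with hA
  have hAc : IsCompact A := isCompact_Icc.inter_right (isClosed_closure.preimage hcont)
  have hAne : A.Nonempty := by
    by_contra hemp
    rw [not_nonempty_iff_eq_empty] at hemp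
    obtain ⟨δ, hδ, hth⟩ := (isCompact_Icc.image hcont).exists_thickening_subset_open
      (isClosed_closure (s := V)).isOpen_compl (s := (fun t : ℝ => x + t • d) '' Icc t₁ 1) <| by
        rintro _ ⟨t, ht, rfl⟩ hc
        exact (hemp ▸ (⟨ht, hc⟩ : t ∈ A) : t ∈ (∅ : Set ℝ))
    obtain ⟨z', hz'd, hz'L, hz'V⟩ := hside (min δ 1) (lt_min hδ one_pos)
    have hlt : ‖(z' - x) - d‖ < min δ 1 := by
      rwa [sub_sub, ← dist_eq_norm]
    obtain ⟨q, hq, hqR⟩ := not_subset.1 hz'V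
    rw [segment_eq_image'] at hq
    obtain ⟨t, ⟨h0, h1⟩, rfl⟩ := hq
    simp only at hqR
    set y := z' - x with hy
    have hyn : ‖y‖ ≤ ‖d‖ + 1 := by
      have := norm_le_norm_add_norm_sub' y d
      have := hlt.trans_le (min_le_right _ _)
      linarith
    have ht : 0 < t := by
      rcases h0.eq_or_lt with rfl | h0
      · rw [zero_smul, add_zero] at hqR
        exact absurd (boundary_subset_region hx) hqR
      · exact h0
    have key : ∀ s, t₁ ≤ s → s ≤ 1 → x + s • y ∈ P.region := by
      intro s hs hs1
      by_contra hsR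
      have hspos : 0 < s := ht₁.trans_le hs
      refine hth (Metric.mem_thickening_iff.2 ⟨x + s • d, ⟨s, ⟨hs, hs1⟩, rfl⟩, ?_⟩)
        (subset_closure ⟨hsR, ?_⟩)
      · rw [dist_add_left, dist_eq_norm, ← smul_sub, norm_smul, Real.norm_of_nonneg hspos.le]
        calc s * ‖y - d‖ ≤ 1 * ‖y - d‖ := mul_le_mul_of_nonneg_right hs1 (norm_nonneg _)
          _ < δ := by rw [one_mul]; exact hlt.trans_le (min_le_left _ _)
      · simp only [mem_ofPred_eq, add_sub_cancel_left, cross2_smul_right]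
        have := mul_pos hspos hz'L
        linarith
    rcases le_or_gt t₁ t with h | h
    · exact hqR (key t h h1)
    · exact hloc₀.smul_notMem ht ht₁ (hnorm t y ht.le h.le hyn) (hnorm t₁ y ht₁.le le_rfl hyn) hqR
        (key t₁ le_rfl ht₁1)
  obtain ⟨τ, ⟨⟨hτ₁, hτ1⟩, hτV⟩, hmax⟩ := hAc.exists_isGreatest hAne
  simp only [mem_preimage] at hτV
  have hτ0 : 0 < τ := ht₁.trans_le hτ₁
  have hτlt : τ < 1 := by
    refine lt_of_le_of_ne hτ1 ?_
    rintro rfl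
    rw [one_smul] at hτV
    exact hVinner _ hz hτV
  have hmax' : ∀ t, τ < t → t ≤ 1 → x + t • d ∉ closure V := fun t h0 h1 hc =>
    h0.not_ge (hmax ⟨⟨hτ₁.trans h0.le, h1⟩, hc⟩)
  set r := x + τ • d with hr
  have hrb : r ∈ P.boundary := by
    have := hvis' τ hτ0.le hτ1
    rw [region_eq] at this
    exact this.resolve_right fun h => hVinner _ h hτV
  obtain ⟨a, b, ρ, hloc, hvtx⟩ := exists_localSectors hg hu hrb
  have hLr : ∀ y, cross2 d (r + y - x) = cross2 d y := fun y => by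
    have : r + y - x = τ • d + y := by rw [hr]; abel
    rw [this, cross2_add_right, cross2_smul_right, cross2_self]; ring
  obtain ⟨s₀, hs₀, hs₀n⟩ := exists_smul_norm_lt d hloc.pos
  set s := min s₀ (min τ (1 - τ)) with hs
  have hspos : 0 < s := lt_min hs₀ (lt_min hτ0 (by linarith))
  have hsn : ‖s • d‖ < ρ := hs₀n s hspos.le (min_le_left _ _)
  have hsτ : s ≤ τ := (min_le_right _ _).trans (min_le_left _ _)
  have hs1 : s ≤ 1 - τ := (min_le_right _ _).trans (min_le_right _ _)
  have hnd : ¬Sector a b d := by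
    refine hloc.not_sector hspos hsn ?_
    have := hvis' (τ + s) (by linarith) (by linarith)
    rwa [add_smul, ← add_assoc] at this
  have hnd' : ¬Sector a b (-d) := by
    refine hloc.not_sector hspos (by rwa [smul_neg, norm_neg]) ?_
    have := hvis' (τ - s) (by linarith) (by linarith)
    rwa [sub_smul, sub_eq_add_neg, ← smul_neg, ← add_assoc] at this
  have hsV : r + s • d ∉ closure V := by
    have := hmax' (τ + s) (by linarith) (by linarith)
    rwa [add_smul, ← add_assoc] at this
  have hfar : ∀ y : E2, 0 < σ * cross2 d y →
      (∀ η : ℝ, 0 < η → ‖s • d + η • y‖ < ρ → r + (s • d + η • y) ∉ P.region) → False := by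
    intro y hy hext
    obtain ⟨η₀, hη₀, hηn⟩ := exists_smul_norm_lt y (sub_pos.2 hsn)
    refine hsV (mem_closure_of_add_smul_mem hη₀ (y := y) fun η h0 h1 => ?_)
    rw [add_assoc]
    refine ⟨hext η h0 ?_, ?_⟩
    · have := norm_add_le (s • d) (η • y)
      have := hηn η h0.le h1
      linarith
    · simp only [mem_ofPred_eq, hLr, cross2_add_right, cross2_smul_right, cross2_self]
      have := mul_pos h0 hy
      linarith
  obtain ⟨y, hyn, hyS, hyL⟩ : ∃ y : E2, ‖y‖ < ρ ∧ Sector a b y ∧ 0 < σ * cross2 d y := by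
    obtain ⟨p, hpV, hp⟩ := Metric.mem_closure_iff.1 hτV ρ hloc.pos
    have hn : ‖p - r‖ < ρ := by rwa [← dist_eq_norm, dist_comm]
    have hpe : r + (p - r) = p := by abel
    refine ⟨p - r, hn, hloc.sector_of_notMem hn (by rw [hpe]; exact hpV.1), ?_⟩
    rw [← hLr, hpe]
    exact hpV.2
  rcases le_or_gt (cross2 a b) 0 with hab | hab
  · exfalso
    rw [sector_of_nonpos hab] at hnd hnd' hyS
    rw [cross2_neg_right, cross2_neg_left] at hnd'
    push Not at hnd hnd'
    refine hfar y hyL fun η hη hn => hloc.exterior _ hn ?_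
    rw [sector_of_nonpos hab, cross2_add_right, cross2_add_left, cross2_smul_right,
      cross2_smul_right, cross2_smul_left, cross2_smul_left,
      show cross2 a d = 0 by linarith [hnd.1, hnd'.1],
      show cross2 d b = 0 by linarith [hnd.2, hnd'.2]]
    exact hyS.imp (fun h => by have := mul_pos hη h; linarith)
      fun h => by have := mul_pos hη h; linarith
  rw [sector_of_pos hab] at hnd hnd' hyS
  rw [cross2_neg_right, cross2_neg_left] at hnd'
  have hcr := mul_cross2_eq a b d y
  have hda := cross2_comm a d
  have hnn : 0 ≤ σ * cross2 d a ∧ 0 ≤ σ * cross2 d b := by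
    have hp := mul_pos hab hyL
    have hcr' : cross2 a b * (σ * cross2 d y) = cross2 y b * (σ * cross2 d a) +
      cross2 a y * (σ * cross2 d b) := by linear_combination σ * hcr
    rw [hcr'] at hp
    by_contra hneg
    rw [not_and_or, not_le, not_le] at hneg
    rcases hneg with hneg | hneg
    · have h1 : 0 < σ * cross2 d b := by
        by_contra h2
        nlinarith [mul_neg_of_pos_of_neg hyS.2 hneg,
          mul_nonneg hyS.1.le (neg_nonneg.2 (not_lt.1 h2))]
      rcases hσ with rfl | rfl
      · exact hnd ⟨by linarith, by linarith⟩
      · exact hnd' ⟨by linarith, by linarith⟩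
    · have h1 : 0 < σ * cross2 d a := by
        by_contra h2
        nlinarith [mul_neg_of_pos_of_neg hyS.1 hneg,
          mul_nonneg hyS.2.le (neg_nonneg.2 (not_lt.1 h2))]
      rcases hσ with rfl | rfl
      · exact hnd' ⟨by linarith, by linarith⟩
      · exact hnd ⟨by linarith, by linarith⟩
  obtain ⟨i, hri, hedges⟩ := hvtx.resolve_right hab.ne'
  have hpos : ∀ e f : E2, P.Corner σ r e f ρ → 0 ≤ σ * cross2 d e → 0 ≤ σ * cross2 d f →
      0 < σ * cross2 d e := by
    intro e f hc he hf
    refine lt_of_le_of_ne he fun h0 => ?_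
    have h0' : cross2 d e = 0 := by
      rcases hσ with rfl | rfl <;> linarith
    obtain ⟨μ, rfl⟩ := eq_smul_of_cross2_eq_zero hd h0'
    have hturn := hc.turn
    rw [cross2_smul_left] at hturn
    have hμ : 0 < μ * (σ * cross2 d f) := by linarith
    have hf' : 0 < σ * cross2 d f := lt_of_le_of_ne hf fun h => by rw [← h] at hμ; simp at hμ
    refine hfar f hf' fun η hη hn => hc.exterior _ hn ?_ ?_
    · simp only [cross2_smul_left, cross2_add_right, cross2_smul_right, cross2_self]
      have := mul_pos hη hμ
      linarith
    · simp only [cross2_smul_left, cross2_add_left, cross2_self]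
      have := mul_pos hspos hf'
      linarith
  have finish : ∀ e f : E2, P.Corner σ r e f ρ → 0 ≤ σ * cross2 d e → 0 ≤ σ * cross2 d f →
      ((e = P.vtx (i + 1) - r ∧ f = P.vtx (i - 1) - r) ∨
        (f = P.vtx (i + 1) - r ∧ e = P.vtx (i - 1) - r)) →
      ∃ (τ : ℝ) (i j : ZMod P.n) (e : E2) (ρ : ℝ), 0 < τ ∧ τ < 1 ∧ x + τ • d = P.vtx i ∧
      (j = i + 1 ∨ j = i - 1) ∧ P.Corner σ (P.vtx i) e (P.vtx j - P.vtx i) ρ ∧ P.IsReflex i ∧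
      0 < σ * cross2 d e ∧ 0 ≤ σ * cross2 d (P.vtx j - P.vtx i) ∧
      ∀ t, τ < t → t ≤ 1 → x + t • d ∉ closure V := by
    intro e f hc he hf hef
    have he' := hpos e f hc he hf
    rw [hri] at hc hef
    rcases hef with ⟨h1, h2⟩ | ⟨h1, h2⟩
    · refine ⟨τ, i, i - 1, e, ρ, hτ0, hτlt, hri, Or.inr rfl, h2 ▸ hc, hc.isReflex ?_, he', h2 ▸ hf,
        hmax'⟩
      rw [h1, h2, add_comm]
    · refine ⟨τ, i, i + 1, e, ρ, hτ0, hτlt, hri, Or.inl rfl, h1 ▸ hc, hc.isReflex ?_, he', h1 ▸ hf,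
        hmax'⟩
      rw [h1, h2]
  rcases hσ with rfl | rfl
  · exact finish a b (hloc.corner hab).1 hnn.1 hnn.2 hedges
  · exact finish b a (hloc.corner hab).2 hnn.2 hnn.1 (hedges.symm.imp id id)

/-- If `x` does not see all interior points, there is a visible point `x + d` which is a limit of
hidden points of a given component, all on one side of the ray. -/
lemma exists_visible_limit {u x c : E2} (hc : c ∈ P.inner) (hu : u ∉ P.region)
    (hx : x ∈ P.boundary) (hxc : ¬segment ℝ x c ⊆ P.region) :
    ∃ (d : E2) (σ : ℝ), (σ = 1 ∨ σ = -1) ∧ x + d ∈ P.inner ∧ segment ℝ x (x + d) ⊆ P.region ∧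
      ∀ ε > 0, ∃ z' ∈ connectedComponentIn (P.inner \ {q | segment ℝ x q ⊆ P.region}) c,
        dist z' (x + d) < ε ∧ 0 < σ * cross2 d (z' - x) := by
  set N : Set E2 := {q | segment ℝ x q ⊆ P.region} with hN
  set H := connectedComponentIn (P.inner \ N) c with hH
  have hNc : IsClosed N := by
    have : N = ⋂ t ∈ Icc (0 : ℝ) 1, (fun q => x + t • (q - x)) ⁻¹' P.region := by
      ext q
      simp only [hN, mem_ofPred_eq, segment_eq_image', image_subset_iff, mem_iInter]
      exact Iff.rfl
    rw [this]
    exact isClosed_biInter fun t _ => isClosed_region.preimage (by fun_prop)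
  have hHo : IsOpen H := (isOpen_inner.sdiff hNc).connectedComponentIn
  have hHs : H ⊆ P.inner \ N := connectedComponentIn_subset _ _
  have hcH : c ∈ H := mem_connectedComponentIn ⟨hc, hxc⟩
  obtain ⟨z, hzI, hzN, hzH⟩ : ∃ z ∈ P.inner, z ∈ N ∧ z ∈ closure H := by
    by_contra! hno
    have hsub : P.inner ⊆ H := by
      refine (isPreconnected_inner hc hu).subset_of_closure_inter_subset hHo ⟨c, hc, hcH⟩ ?_
      rintro q ⟨hq, hqI⟩
      exact mem_connectedComponentIn_of_mem_closure hq ⟨hqI, fun h => hno q hqI h hq⟩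
    obtain ⟨a, b, ρ, h, -⟩ := exists_localSectors hc hu hx
    obtain ⟨y, hy, -⟩ := h.distinct.symm.exists_sector
    obtain ⟨ε, hε, hb⟩ := exists_smul_norm_lt y h.pos
    have hin : ∀ s, 0 < s → s ≤ ε → x + s • y ∈ P.inner := fun s h0 h1 =>
      h.interior _ (hb s h0.le h1) (hy.smul h0)
    refine (hHs (hsub (hin ε hε le_rfl))).2 fun q hq => ?_
    obtain ⟨s, h0, h1, rfl⟩ := (mem_segment_add_smul_iff hε).1 hq
    rcases h0.eq_or_lt with rfl | h0
    · simpa using boundary_subset_region hx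
    · exact inner_subset_region (hin s h0 h1)
  obtain ⟨d, rfl⟩ : ∃ d, z = x + d := ⟨z - x, by abel⟩
  have hd : d ≠ 0 := by
    rintro rfl
    rw [add_zero] at hzI
    exact hzI.1 hx
  obtain ⟨ε₀, hε₀, hball⟩ := Metric.isOpen_iff.1 isOpen_inner _ hzI
  have hoff : ∀ z' ∈ H, dist z' (x + d) < ε₀ → cross2 d (z' - x) ≠ 0 := by
    intro z' hz' hdist h0
    have hsegI : segment ℝ (x + d) z' ⊆ P.inner :=
      ((convex_ball _ _).segment_subset (Metric.mem_ball_self hε₀) hdist).trans hball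
    refine (hHs hz').2 ?_
    obtain ⟨s, hs⟩ := eq_smul_of_cross2_eq_zero hd h0
    obtain rfl : z' = x + s • d := by rw [← hs]; abel
    rcases lt_or_ge s 0 with hs0 | hs0
    · refine absurd hx (hsegI ⟨-s / (1 - s), 1 / (1 - s), div_nonneg (by linarith) (by linarith),
        div_nonneg zero_le_one (by linarith), ?_, ?_⟩).1
      · have : 1 - s ≠ 0 := by linarith
        field_simp; ring
      · have h1 : 1 - s ≠ 0 := by linarith
        have h2 : -s / (1 - s) + 1 / (1 - s) = 1 := by field_simp; ring
        have h3 : -s / (1 - s) + 1 / (1 - s) * s = 0 := by field_simp; ring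
        calc (-s / (1 - s)) • (x + d) + (1 / (1 - s)) • (x + s • d)
            = (-s / (1 - s) + 1 / (1 - s)) • x + (-s / (1 - s) + 1 / (1 - s) * s) • d := by module
          _ = x := by rw [h2, h3]; simp
    rcases le_or_gt s 1 with hs1 | hs1
    · refine ((convex_segment x (x + d)).segment_subset (left_mem_segment ℝ _ _) ?_).trans hzN
      rw [segment_add_eq_image]
      exact ⟨s, ⟨hs0, hs1⟩, rfl⟩
    · have hmem : x + d ∈ segment ℝ x (x + s • d) :=
        (mem_segment_add_smul_iff (by linarith)).2 ⟨1, zero_le_one, hs1.le, by rw [one_smul]⟩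
      refine (segment_subset_union_of_mem hmem).trans (union_subset ?_ ?_)
      · exact hsegI.trans inner_subset_region
      · rw [segment_symm]; exact hzN
  by_contra! hno
  obtain ⟨ε₁, hε₁, h₁⟩ := hno d 1 (Or.inl rfl) hzI hzN
  obtain ⟨ε₂, hε₂, h₂⟩ := hno d (-1) (Or.inr rfl) hzI hzN
  obtain ⟨z', hz', hdist⟩ := Metric.mem_closure_iff.1 hzH _ (lt_min hε₀ (lt_min hε₁ hε₂))
  rw [dist_comm, lt_min_iff, lt_min_iff] at hdist
  have h1 := h₁ z' hz' hdist.2.1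
  have h2 := h₂ z' hz' hdist.2.2
  exact hoff z' hz' hdist.1 (by linarith)

end SimplePolygon

lemma notMem_segment_of_cross2_ne_zero {r δ q : E2} {T : ℝ} (h : cross2 δ (q - r) ≠ 0) :
    q ∉ segment ℝ r (r + T • δ) := by
  rw [segment_add_eq_image]
  rintro ⟨t, -, rfl⟩
  exact h (by simp [cross2_smul_right, cross2_self])

namespace SimplePolygon

variable {P : SimplePolygon}

/-- Let `d` be tangent to the exterior cone at `r`. A connected set that comes close to the ray
`r + s • d` from the side of the cone, without meeting its visible part, does not meet the chord
extending the edge in the direction `f`. -/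
lemma Corner.disjoint_chord {g u r e f d : E2} {σ ρ T : ℝ} (hg : g ∈ P.inner) (hu : u ∉ P.region)
    (hr : r ∈ P.boundary) (h : P.Corner σ r e f ρ) (hde : 0 < σ * cross2 d e)
    (hdf : 0 ≤ σ * cross2 d f) (hT : 0 < T) (hω : r + T • (-f) ∈ P.boundary)
    (hin : ∀ s, 0 < s → s < T → r + s • (-f) ∈ P.inner) :
    ∃ t₀ > (0 : ℝ), ∀ t, 0 < t → t ≤ t₀ → ∀ S : Set E2, IsPreconnected S → S ⊆ P.region →
      (∀ s : ℝ, 0 ≤ s → r + s • d ∈ S → ¬segment ℝ r (r + s • d) ⊆ P.region) →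
      (∃ η₀ > (0 : ℝ), ∀ η, 0 < η → η ≤ η₀ → r + t • d + η • e ∈ S) →
      Disjoint S (segment ℝ r (r + T • (-f))) := by
  have hd : d ≠ 0 := by
    rintro rfl
    simp [cross2] at hde
  have hchord := chord_subset_region hT hr hω hin
  obtain ⟨ε, hε, hεd⟩ := exists_smul_norm_lt d h.pos
  obtain ⟨T₁, hT₁, hω₁, hin₁⟩ := exists_first_hit (r := r) (isBounded_inner hg hu) hd hε
    fun s h0 h1 => h.interior _ (hεd s h0.le h1) <| Or.inl <| by
      rw [cross2_smul_right, cross2_comm d e]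
      have := mul_pos h0 hde
      linarith
  have hchord₁ := chord_subset_region hT₁ hr hω₁ hin₁
  refine ⟨min ε (T₁ / 2), lt_min hε (half_pos hT₁), fun t ht htle S hS hSR hray hnear => ?_⟩
  have htT : t < T₁ := by have := htle.trans (min_le_right _ _); linarith
  have htn : ‖t • d‖ < ρ := hεd t ht.le (htle.trans (min_le_left _ _))
  have hSW : S ⊆ P.region \ segment ℝ r (r + T₁ • d) := by
    refine fun q hq => ⟨hSR hq, fun hqW => ?_⟩
    obtain ⟨s, h0, h1, rfl⟩ := (mem_segment_add_smul_iff hT₁).1 hqW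
    exact hray s h0 hq (((convex_segment _ _).segment_subset (left_mem_segment ℝ _ _) hqW).trans
      hchord₁)
  rw [disjoint_left]
  intro q hqS hqC
  obtain ⟨s, h0, h1, rfl⟩ := (mem_segment_add_smul_iff hT).1 hqC
  rcases hdf.eq_or_lt with hdf0 | hdf
  · have hdf0' : cross2 d f = 0 := by rcases h.sign with rfl | rfl <;> linarith
    obtain ⟨μ, rfl⟩ := eq_smul_of_cross2_eq_zero hd hdf0'
    have hμ : μ < 0 := by
      have := h.turn
      rw [cross2_smul_right, cross2_comm d e] at this
      by_contra hμ
      nlinarith [mul_nonneg (not_lt.1 hμ) hde.le]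
    have he : r + s • (-(μ • d)) = r + (s * -μ) • d := by module
    have hsub := (convex_segment _ _).segment_subset (left_mem_segment ℝ _ _) hqC
    rw [he] at hqS hsub
    exact hray _ (mul_nonneg h0 (by linarith)) hqS (hsub.trans hchord)
  have hs : 0 < s := by
    refine lt_of_le_of_ne h0 ?_
    rintro rfl
    refine hray 0 le_rfl (by simpa using hqS) ?_
    simpa using boundary_subset_region hr
  obtain ⟨ε', hε', -, hsep⟩ := chord_separates hg hu hr hω₁ hin₁ ht htT
  obtain ⟨η₀, hη₀, hη₀S⟩ := hnear
  obtain ⟨η₁, hη₁, hη₁e⟩ := exists_smul_norm_lt e (lt_min hε' (sub_pos.2 htn))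
  set η := min η₀ η₁ with hη
  have hηpos : 0 < η := lt_min hη₀ hη₁
  have hηe := hη₁e η hηpos.le (min_le_right _ _)
  rw [lt_min_iff] at hηe
  obtain ⟨s₂, hs₂, hs₂f⟩ := exists_smul_norm_lt (-f) h.pos
  set s₁ := min s₂ T with hs₁
  have hs₁pos : 0 < s₁ := lt_min hs₂ hT
  set p₂ := r + t • d + (-η) • e with hp₂
  set ray : Set E2 := (fun s : ℝ => r + s • (-f)) '' Ioc 0 T with hraydef
  set S₂ : Set E2 := segment ℝ p₂ (r + s₁ • (-f)) ∪ ray with hS₂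
  have hrayc : IsPreconnected ray := isPreconnected_Ioc.image _ (by fun_prop)
  have hs₁ray : r + s₁ • (-f) ∈ ray := ⟨s₁, ⟨hs₁pos, min_le_right _ _⟩, rfl⟩
  have hS₂c : IsPreconnected S₂ := (convex_segment p₂ (r + s₁ • (-f))).isPreconnected.union
    (r + s₁ • (-f)) (right_mem_segment ℝ _ _) hs₁ray hrayc
  have hneg : ∀ q, 0 < -σ * cross2 d (q - r) → q ∉ segment ℝ r (r + T₁ • d) := fun q hq =>
    notMem_segment_of_cross2_ne_zero fun h => by rw [h] at hq; simp at hq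
  have hS₂W : S₂ ⊆ P.region \ segment ℝ r (r + T₁ • d) := by
    refine union_subset ?_ ?_
    · have hsub := ((convex_ball r ρ).inter (convex_cross2_pos (-σ) d r)).segment_subset
        (x := p₂) (y := r + s₁ • (-f)) ⟨?_, ?_⟩ ⟨?_, ?_⟩
      · intro q hq
        obtain ⟨hqb, hqL⟩ := hsub hq
        refine ⟨inner_subset_region ?_, hneg q hqL⟩
        have := h.interior_of_supporting (y := q - r) hde.le hdf.le
          (by rwa [mem_ball_iff_norm] at hqb) (by simp only [mem_ofPred_eq] at hqL; linarith)
        rwa [add_sub_cancel] at this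
      · rw [mem_ball_iff_norm, hp₂, add_assoc, add_sub_cancel_left]
        have := norm_add_le (t • d) ((-η) • e)
        rw [neg_smul, norm_neg] at this
        rw [neg_smul]
        linarith [hηe.2]
      · simp only [mem_ofPred_eq, hp₂, add_assoc, add_sub_cancel_left, cross2_add_right,
          cross2_smul_right, cross2_self]
        have := mul_pos hηpos hde
        linarith
      · rw [mem_ball_iff_norm, add_sub_cancel_left]
        exact hs₂f _ hs₁pos.le (min_le_left _ _)
      · simp only [mem_ofPred_eq, add_sub_cancel_left, cross2_smul_right, cross2_neg_right]
        have := mul_pos hs₁pos hdf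
        linarith
    · rintro _ ⟨s', hs', rfl⟩
      refine ⟨hchord ((mem_segment_add_smul_iff hT).2 ⟨s', hs'.1.le, hs'.2, rfl⟩), hneg _ ?_⟩
      simp only [add_sub_cancel_left, cross2_smul_right, cross2_neg_right]
      have := mul_pos hs'.1 hdf
      linarith
  refine hsep (r + t • d + η • e) ?_ p₂ ?_ ?_ (S ∪ S₂)
    (hS.union (r + s • (-f)) hqS (Or.inr ⟨s, ⟨hs, h1⟩, rfl⟩) hS₂c) (union_subset hSW hS₂W)
    (Or.inl (hη₀S η hηpos (min_le_left _ _))) (Or.inr (Or.inl (left_mem_segment ℝ _ _)))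
  · rw [mem_ball_iff_norm, add_sub_cancel_left]
    exact hηe.1
  · rw [mem_ball_iff_norm, hp₂, add_sub_cancel_left, neg_smul, norm_neg]
    exact hηe.1
  · simp only [hp₂, add_assoc, add_sub_cancel_left, cross2_add_right, cross2_smul_right,
      cross2_self]
    have hne : cross2 d e ≠ 0 := fun h => by rw [h] at hde; simp at hde
    have : 0 < η * cross2 d e * (η * cross2 d e) := mul_self_pos.2 (mul_ne_zero hηpos.ne' hne)
    linarith

/-- A connected set coming close to the corner from the inner side of the chord extending the edge
in the direction `f`, without meeting the chord, does not meet the part of the region cut off by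
that chord on the side of the edge. -/
lemma Corner.disjoint_component {g u r e f d : E2} {σ ρ T t : ℝ} (hg : g ∈ P.inner)
    (hu : u ∉ P.region) (hf : segment ℝ r (r + f) ⊆ P.boundary)
    (h : P.Corner σ r e f ρ) (hde : 0 < σ * cross2 d e)
    (hdf : 0 ≤ σ * cross2 d f) (hT : 0 < T) (hω : r + T • (-f) ∈ P.boundary)
    (hin : ∀ s, 0 < s → s < T → r + s • (-f) ∈ P.inner) (ht : 0 < t) (htn : ‖t • d‖ < ρ)
    {S : Set E2} (hS : IsPreconnected S) (hSR : S ⊆ P.region \ segment ℝ r (r + T • (-f)))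
    (hnear : ∃ η₀ > (0 : ℝ), ∀ η, 0 < η → η ≤ η₀ → r + t • d + η • e ∈ S) :
    (∀ s : ℝ, 0 < s → s ≤ 1 →
      r + s • f ∈ connectedComponentIn (P.region \ segment ℝ r (r + T • (-f))) (r + f)) ∧
    Disjoint S (connectedComponentIn (P.region \ segment ℝ r (r + T • (-f))) (r + f)) := by
  set K := connectedComponentIn (P.region \ segment ℝ r (r + T • (-f))) (r + f) with hK
  have hturn := h.turn
  have hr : r ∈ P.boundary := hf (left_mem_segment ℝ _ _)
  have hf0 : f ≠ 0 := by
    rintro rfl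
    simp [cross2] at hturn
  have hedge : ∀ s : ℝ, 0 < s → s ≤ 1 → r + s • f ∈ K := by
    intro s h0 h1
    have hpre : IsPreconnected ((fun s : ℝ => r + s • f) '' Ioc 0 1) :=
      isPreconnected_Ioc.image _ (by fun_prop)
    refine hpre.subset_connectedComponentIn ⟨1, ⟨zero_lt_one, le_rfl⟩, by simp⟩ ?_
      ⟨s, ⟨h0, h1⟩, rfl⟩
    rintro _ ⟨s', hs', rfl⟩
    refine ⟨boundary_subset_region (hf ?_), fun hc => ?_⟩
    · rw [segment_add_eq_image]
      exact ⟨s', ⟨hs'.1.le, hs'.2⟩, rfl⟩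
    · obtain ⟨s'', h0'', -, he⟩ := (mem_segment_add_smul_iff hT).1 hc
      have hz : (s' + s'') • f = 0 := by
        have := add_left_cancel he
        rw [add_smul, this, smul_neg, neg_add_cancel]
      rcases smul_eq_zero.1 hz with hz | hz
      · linarith [hs'.1]
      · exact hf0 hz
  refine ⟨hedge, disjoint_left.2 fun q hqS hqK => ?_⟩
  have hturn' : cross2 f e = -cross2 e f := cross2_comm e f
  obtain ⟨ε, hε, hεf⟩ := exists_smul_norm_lt (-f) h.pos
  set t' := min ε (T / 2) with ht'
  have ht'pos : 0 < t' := lt_min hε (half_pos hT)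
  have ht'T : t' < T := (min_le_right _ _).trans_lt (half_lt_self hT)
  have ht'n : ‖t' • (-f)‖ < ρ := hεf t' ht'pos.le (min_le_left _ _)
  obtain ⟨ε', hε', -, hsep⟩ := chord_separates hg hu hr hω hin ht'pos ht'T
  obtain ⟨η', hη', hη'e⟩ := exists_smul_norm_lt e (lt_min hε' (sub_pos.2 ht'n))
  replace hη'e := hη'e η' hη'.le le_rfl
  rw [lt_min_iff] at hη'e
  obtain ⟨η₀, hη₀, hη₀S⟩ := hnear
  obtain ⟨η₁, hη₁, hη₁e⟩ := exists_smul_norm_lt e (sub_pos.2 htn)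
  set η := min η₀ η₁ with hη
  have hηpos : 0 < η := lt_min hη₀ hη₁
  have hηe := hη₁e η hηpos.le (min_le_right _ _)
  set p := r + t • d + η • e with hp
  set p₁ := r + t' • (-f) + η' • e with hp₁
  set p₂ := r + t' • (-f) + (-η') • e with hp₂
  have hpS : p ∈ S := hη₀S η hηpos (min_le_left _ _)
  have hA₁ : segment ℝ p p₁ ⊆ P.region \ segment ℝ r (r + T • (-f)) := by
    have hsub := (((convex_ball r ρ).inter (convex_cross2_pos σ (-f) r)).inter
      (convex_cross2_pos (-σ) e r)).segment_subset
        (x := p) (y := p₁) ⟨⟨?_, ?_⟩, ?_⟩ ⟨⟨?_, ?_⟩, ?_⟩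
    · intro z hz
      obtain ⟨⟨hzb, hz1⟩, hz2⟩ := hsub hz
      simp only [mem_ofPred_eq] at hz1 hz2
      refine ⟨inner_subset_region ?_, notMem_segment_of_cross2_ne_zero fun h => ?_⟩
      · have := h.interior (z - r) (by rwa [mem_ball_iff_norm] at hzb) (Or.inl (by linarith))
        rwa [add_sub_cancel] at this
      · rw [h] at hz1; simp at hz1
    · rw [mem_ball_iff_norm, hp, add_assoc, add_sub_cancel_left]
      have := norm_add_le (t • d) (η • e)
      linarith
    · simp only [mem_ofPred_eq, hp, add_assoc, add_sub_cancel_left, cross2_add_right,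
        cross2_smul_right, cross2_neg_left, hturn', cross2_comm d f]
      have := mul_pos hηpos hturn
      have := mul_nonneg ht.le hdf
      linarith
    · simp only [mem_ofPred_eq, hp, add_assoc, add_sub_cancel_left, cross2_add_right,
        cross2_smul_right, cross2_self, cross2_comm d e]
      have := mul_pos ht hde
      linarith
    · rw [mem_ball_iff_norm, hp₁, add_assoc, add_sub_cancel_left]
      have := norm_add_le (t' • (-f)) (η' • e)
      linarith [hη'e.2]
    · simp only [mem_ofPred_eq, hp₁, add_assoc, add_sub_cancel_left, cross2_add_right,
        cross2_smul_right, cross2_neg_left, hturn', cross2_neg_right, cross2_self]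
      have := mul_pos hη' hturn
      linarith
    · simp only [mem_ofPred_eq, hp₁, add_assoc, add_sub_cancel_left, cross2_add_right,
        cross2_smul_right, cross2_self, cross2_neg_right]
      have := mul_pos ht'pos hturn
      linarith
  obtain ⟨s₂, hs₂, hs₂f⟩ := exists_smul_norm_lt f h.pos
  set s₁ := min s₂ 1 with hs₁
  have hs₁pos : 0 < s₁ := lt_min hs₂ one_pos
  have hbK : r + s₁ • f ∈ K := hedge s₁ hs₁pos (min_le_right _ _)
  have hA₂ : segment ℝ (r + s₁ • f) p₂ ⊆ P.region \ segment ℝ r (r + T • (-f)) := by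
    intro z hz
    have hzb : z ∈ Metric.ball r ρ := by
      refine (convex_ball r ρ).segment_subset ?_ ?_ hz
      · rw [mem_ball_iff_norm, add_sub_cancel_left]
        exact hs₂f _ hs₁pos.le (min_le_left _ _)
      · rw [mem_ball_iff_norm, hp₂, add_assoc, add_sub_cancel_left]
        have := norm_add_le (t' • (-f)) ((-η') • e)
        rw [neg_smul, norm_neg] at this
        rw [neg_smul]
        linarith [hη'e.2]
    rw [mem_ball_iff_norm] at hzb
    obtain ⟨α, β, hα, hβ, hαβ, rfl⟩ := hz
    rcases hβ.eq_or_lt with rfl | hβ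
    · have : α = 1 := by linarith
      rw [this, one_smul, zero_smul, add_zero]
      exact connectedComponentIn_subset _ _ hbK
    have hy : α • (r + s₁ • f) + β • p₂ - r = (α * s₁ - β * t') • f + (-(β * η')) • e := by
      obtain rfl : α = 1 - β := by linarith
      rw [hp₂]; module
    have hcr := mul_pos (mul_pos hβ hη') hturn
    rw [hy] at hzb
    refine ⟨inner_subset_region ?_, notMem_segment_of_cross2_ne_zero fun h => ?_⟩
    · have := h.interior _ hzb (Or.inr (by
        simp only [cross2_add_left, cross2_smul_left, cross2_self]; linarith))
      rwa [← hy, add_sub_cancel] at this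
    · rw [hy] at h
      simp only [cross2_add_right, cross2_smul_right, cross2_neg_left, cross2_self, hturn'] at h
      have hz : β * η' * cross2 e f = 0 := by linarith
      have : β * η' * (σ * cross2 e f) = 0 := by linear_combination σ * hz
      linarith
  have hc₁ : IsPreconnected (S ∪ segment ℝ p p₁) :=
    hS.union p hpS (left_mem_segment ℝ _ _) (convex_segment _ _).isPreconnected
  have hc₂ : IsPreconnected (K ∪ segment ℝ (r + s₁ • f) p₂) :=
    isPreconnected_connectedComponentIn.union _ hbK (left_mem_segment ℝ _ _)
      (convex_segment _ _).isPreconnected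
  refine hsep p₁ ?_ p₂ ?_ ?_ _ (hc₁.union q (Or.inl hqS) (Or.inl hqK) hc₂)
    (union_subset (union_subset hSR hA₁) (union_subset (connectedComponentIn_subset _ _) hA₂))
    (Or.inl (Or.inr (right_mem_segment ℝ _ _))) (Or.inr (Or.inr (right_mem_segment ℝ _ _)))
  · rw [mem_ball_iff_norm, add_sub_cancel_left]
    exact hη'e.1
  · rw [mem_ball_iff_norm, hp₂, add_sub_cancel_left, neg_smul, norm_neg]
    exact hη'e.1
  · simp only [hp₁, hp₂, add_assoc, add_sub_cancel_left, cross2_add_right, cross2_smul_right,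
      cross2_self, cross2_neg_left, hturn']
    have hne : cross2 e f ≠ 0 := fun h => by rw [h] at hturn; simp at hturn
    have : 0 < η' * cross2 e f * (η' * cross2 e f) := mul_self_pos.2 (mul_ne_zero hη'.ne' hne)
    linarith

end SimplePolygon

namespace SimplePolygon

variable {P : SimplePolygon}

lemma exists_thickening_inter_subset_inner {u x d : E2} {σ τ t : ℝ} (hu : u ∉ P.region)
    (hτ : ∀ s, τ < s → s ≤ 1 →
      x + s • d ∉ closure (P.regionᶜ ∩ {q | 0 < σ * cross2 d (q - x)}))
    (htτ : τ < t) (ht1 : t ≤ 1) : ∃ δ > 0,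
      Metric.thickening δ (segment ℝ (x + t • d) (x + d)) ∩ {q | 0 < σ * cross2 d (q - x)} ⊆
        P.inner := by
  obtain ⟨δ, hδ, hth⟩ := (isCompact_segment (x + t • d) (x + d)).exists_thickening_subset_open
    (isClosed_closure (s := P.regionᶜ ∩ {q | 0 < σ * cross2 d (q - x)})).isOpen_compl <| by
      rintro _ ⟨α, β, hα, hβ, hαβ, rfl⟩
      have e : α • (x + t • d) + β • (x + d) = x + (α * t + β) • d := by
        obtain rfl : β = 1 - α := by linarith
        module
      rw [e]
      refine hτ _ ?_ ?_
      · nlinarith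
      · nlinarith
  refine ⟨δ, hδ, fun q hq => ?_⟩
  have hqV := hth hq.1
  by_contra hqI
  refine hqV (mem_closure_iff.2 fun O hO hqO => ?_)
  have hqU : q ∈ closure P.regionᶜ := by
    by_cases hqR : q ∈ P.region
    · rw [region_eq] at hqR
      exact boundary_subset_closure_compl_region hu (hqR.resolve_right hqI)
    · exact subset_closure hqR
  obtain ⟨p, ⟨hpO, hpL⟩, hpU⟩ := mem_closure_iff.1 hqU _ (hO.inter (isOpen_cross2_pos σ d x))
    ⟨hqO, hq.2⟩
  exact ⟨p, hpO, hpU, hpL⟩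

lemma Cut.segment_subset_boundary (C : P.Cut) : segment ℝ C.v C.u ⊆ P.boundary := by
  unfold Cut.v Cut.u
  rcases C.adj with h | h
  · rw [h]; exact P.segment_subset_boundary C.i
  · have := P.segment_subset_boundary (C.i - 1)
    rwa [sub_add_cancel, segment_symm, ← h] at this

lemma IsReflex.exists_notMem_region {i : ZMod P.n} (h : P.IsReflex i) : ∃ u, u ∉ P.region := by
  obtain ⟨ε, hε, h⟩ := h
  exact ⟨_, h (ε / 2) ⟨half_pos hε, half_lt_self hε⟩⟩

lemma Cut.exists_mem_seg_inner (C : P.Cut) : ∃ c ∈ C.seg, c ∈ P.inner := by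
  have ht := half_pos C.t_pos
  have hmem : P.vtx C.i + (C.t / 2) • (P.vtx C.i - P.vtx C.j) ∈ C.seg :=
    (mem_segment_add_smul_iff C.t_pos).2 ⟨_, ht.le, by linarith [C.t_pos], rfl⟩
  refine ⟨_, hmem, ?_⟩
  have hreg := C.inside hmem
  rw [region_eq] at hreg
  exact hreg.resolve_left (C.first_hit _ ⟨ht, half_lt_self C.t_pos⟩)

/-- A cut disjoint from `C` whose pocket does not meet `C` and is connected to a point `x` of the
pocket of `C` inside the complement of `C` makes `C` redundant. -/
lemma Cut.redundant_of_connected (C C' : P.Cut) {x : E2}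
    (hx : x ∈ connectedComponentIn (P.region \ C.seg) C.u)
    (hxv : segment ℝ x C'.v ⊆ P.region \ C.seg) (hseg : Disjoint C.seg C'.seg)
    (hcomp : Disjoint C.seg (connectedComponentIn (P.region \ C'.seg) C'.u))
    (hedge : segment ℝ C'.v C'.u ⊆ P.region \ C.seg)
    (hu : C'.u ∈ connectedComponentIn (P.region \ C'.seg) C'.u) : C.Redundant := by
  set K := connectedComponentIn (P.region \ C.seg) C.u with hK
  set K' := connectedComponentIn (P.region \ C'.seg) C'.u with hK'
  have hseg' : C'.seg ⊆ P.region \ C.seg := fun q hq => ⟨C'.inside hq, hseg.notMem_of_mem_right hq⟩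
  have hcomp' : K' ⊆ P.region \ C.seg := fun q hq =>
    ⟨(connectedComponentIn_subset _ _ hq).1, hcomp.notMem_of_mem_right hq⟩
  have hpre : IsPreconnected ((segment ℝ x C'.v ∪ C'.seg) ∪ (segment ℝ C'.v C'.u ∪ K')) := by
    refine IsPreconnected.union C'.v (Or.inl (right_mem_segment ℝ _ _))
      (Or.inl (left_mem_segment ℝ _ _)) ?_ ?_
    · exact (convex_segment _ _).isPreconnected.union C'.v (right_mem_segment ℝ _ _)
        (left_mem_segment ℝ _ _) (convex_segment _ _).isPreconnected
    · exact (convex_segment _ _).isPreconnected.union C'.u (right_mem_segment ℝ _ _) hu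
        isPreconnected_connectedComponentIn
  have hsub := hpre.subset_connectedComponentIn (x := x)
    (Or.inl (Or.inl (left_mem_segment ℝ _ _)))
    (union_subset (union_subset hxv hseg') (union_subset hedge hcomp'))
  rw [← connectedComponentIn_eq hx] at hsub
  obtain ⟨c, hcseg, hcI⟩ := C.exists_mem_seg_inner
  refine ⟨C', ⟨?_, fun hle => ?_⟩⟩
  · refine union_subset ?_ ?_
    · exact (closure_mono fun q hq => hsub (Or.inr (Or.inr hq))).trans subset_union_left
    · exact fun q hq => Or.inl (subset_closure (hsub (Or.inl (Or.inr hq))))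
  · rcases hle (Or.inr hcseg) with hc | hc
    · refine hcomp.notMem_of_mem_left hcseg (mem_connectedComponentIn_of_mem_closure hc ?_)
      exact ⟨inner_subset_region hcI, hseg.notMem_of_mem_left hcseg⟩
    · exact hseg.notMem_of_mem_left hcseg hc

end SimplePolygon

open SimplePolygon

/-- For a nonredundant cut `C` of a simple polygon `P`, every vertex
of `Pocket(C)` sees at least one point of the segment `C`. -/
theorem pocket_vertex_sees_cut (P : SimplePolygon) (C : P.Cut) (hC : C.Nonredundant)
    (x : E2) (hx : C.PocketVertex x) :
    ∃ p ∈ C.seg, P.Visible x p := by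
  by_contra! hno
  simp only [Visible] at hno
  obtain ⟨u, hu⟩ := C.reflex.exists_notMem_region
  obtain ⟨c, hcC, hcI⟩ := C.exists_mem_seg_inner
  have hxC : x ∉ C.seg := fun h => hno x h (by
    rw [segment_same, singleton_subset_iff]; exact C.inside h)
  obtain ⟨k, rfl, hxp⟩ := hx.resolve_left fun h => hxC (h ▸ right_mem_segment ℝ _ _)
  have hxb : P.vtx k ∈ P.boundary := P.vtx_mem_boundary k
  set x := P.vtx k
  have hxK := mem_connectedComponentIn_of_mem_closure (hxp.resolve_right hxC)
    ⟨boundary_subset_region hxb, hxC⟩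
  obtain ⟨d, σ, hσ, hzI, hzv, hlim⟩ := exists_visible_limit hcI hu hxb (hno c hcC)
  set H := connectedComponentIn (P.inner \ {q | segment ℝ x q ⊆ P.region}) c with hH
  have hHs : H ⊆ P.inner \ {q | segment ℝ x q ⊆ P.region} := connectedComponentIn_subset _ _
  have hcH : c ∈ H := mem_connectedComponentIn ⟨hcI, hno c hcC⟩
  obtain ⟨τ, i, j, e, ρ, hτ0, hτ1, hr, hij, hcor, hrefl, hde, hdf, hmax⟩ :=
    exists_corner hcI hu hxb hσ hzI hzv fun ε hε => by
      obtain ⟨z', hz', h1, h2⟩ := hlim ε hε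
      exact ⟨z', h1, h2, (hHs hz').2⟩
  set r := P.vtx i with hrdef
  set f := P.vtx j - r with hf
  have hrb : r ∈ P.boundary := P.vtx_mem_boundary i
  have hturn := hcor.turn
  have hf0 : f ≠ 0 := by
    intro h
    rw [h] at hturn
    simp [cross2] at hturn
  obtain ⟨ε₁, hε₁, hε₁f⟩ := exists_smul_norm_lt (-f) hcor.pos
  obtain ⟨T, hT, hω, hin⟩ := exists_first_hit (r := r) (isBounded_inner hcI hu) (neg_ne_zero.2 hf0)
    hε₁ fun s h0 h1 => hcor.interior _ (hε₁f s h0.le h1) <| Or.inl <| by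
      rw [cross2_smul_right, cross2_neg_right]
      have := mul_pos h0 hturn
      linarith
  have hfneg : P.vtx i - P.vtx j = -f := by rw [hf]; abel
  let C' : P.Cut :=
    { i := i, j := j, adj := hij, reflex := hrefl, t := T, t_pos := hT
      hits := by rw [hfneg]; exact hω
      first_hit := fun s hs => by rw [hfneg]; exact (hin s hs.1 hs.2).1
      inside := by rw [hfneg]; exact chord_subset_region hT hrb hω hin }
  have hC'seg : C'.seg = segment ℝ r (r + T • (-f)) := by rw [← hfneg]; rfl
  have hC'u : C'.u = r + f := by rw [hf, add_sub_cancel]; rfl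
  obtain ⟨t₀, ht₀, hA⟩ := hcor.disjoint_chord hcI hu hrb hde hdf hT hω hin
  obtain ⟨ε₂, hε₂, hε₂d⟩ := exists_smul_norm_lt d hcor.pos
  set t := min (min t₀ ε₂) (1 - τ) with ht
  have htpos : 0 < t := lt_min (lt_min ht₀ hε₂) (by linarith)
  have htt₀ : t ≤ t₀ := (min_le_left _ _).trans (min_le_left _ _)
  have htn : ‖t • d‖ < ρ := hε₂d t htpos.le ((min_le_left _ _).trans (min_le_right _ _))
  have htτ : t ≤ 1 - τ := min_le_right _ _
  have hray : ∀ s : ℝ, r + s • d = x + (τ + s) • d := fun s => by rw [← hr]; module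
  have hcross : ∀ y : E2, cross2 d (r + y - x) = cross2 d y := fun y => by
    have : r + y - x = τ • d + y := by rw [← hr]; abel
    rw [this, cross2_add_right, cross2_smul_right, cross2_self]; ring
  obtain ⟨δ, hδ, hδI⟩ := exists_thickening_inter_subset_inner hu hmax (t := τ + t)
    (by linarith) (by linarith)
  set strip : Set E2 := Metric.thickening δ (segment ℝ (x + (τ + t) • d) (x + d)) ∩
    {q | 0 < σ * cross2 d (q - x)} with hstrip
  have hstripc : Convex ℝ strip := ((convex_segment _ _).thickening δ).inter
    (convex_cross2_pos σ d x)
  set S := C.seg ∪ H ∪ strip with hS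
  have hSc : IsPreconnected S := by
    obtain ⟨z', hz'H, hz'd, hz'L⟩ := hlim δ hδ
    refine IsPreconnected.union z' (Or.inr hz'H) ⟨?_, hz'L⟩ ?_ hstripc.isPreconnected
    · exact Metric.mem_thickening_iff.2 ⟨_, right_mem_segment ℝ _ _, hz'd⟩
    · exact (convex_segment _ _).isPreconnected.union c hcC hcH isPreconnected_connectedComponentIn
  have hSR : S ⊆ P.region := union_subset (union_subset C.inside
    fun q hq => inner_subset_region (hHs hq).1) (hδI.trans inner_subset_region)
  have hxr : segment ℝ x r ⊆ P.region := by
    refine ((convex_segment _ _).segment_subset (left_mem_segment ℝ _ _) ?_).trans hzv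
    rw [segment_add_eq_image]
    exact ⟨τ, ⟨hτ0.le, hτ1.le⟩, hr⟩
  have hvis : ∀ s : ℝ, 0 ≤ s → segment ℝ r (r + s • d) ⊆ P.region →
      segment ℝ x (r + s • d) ⊆ P.region := by
    intro s hs hsR
    have hmem : r ∈ segment ℝ x (r + s • d) := by
      rw [hray]
      exact (mem_segment_add_smul_iff (by linarith)).2 ⟨τ, hτ0.le, by linarith, hr.symm⟩
    refine (segment_subset_union_of_mem hmem).trans (union_subset hsR ?_)
    rwa [segment_symm]
  have hSray : ∀ s : ℝ, 0 ≤ s → r + s • d ∈ S → ¬segment ℝ r (r + s • d) ⊆ P.region := by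
    rintro s hs ((hq | hq) | hq) hsR
    · exact hno _ hq (hvis s hs hsR)
    · exact (hHs hq).2 (hvis s hs hsR)
    · have := hq.2
      simp only [mem_ofPred_eq, hcross, cross2_smul_right, cross2_self] at this
      simp at this
  have hnear : ∃ η₀ > (0 : ℝ), ∀ η, 0 < η → η ≤ η₀ → r + t • d + η • e ∈ S := by
    obtain ⟨η₀, hη₀, hηe⟩ := exists_smul_norm_lt e hδ
    refine ⟨η₀, hη₀, fun η h0 h1 => Or.inr ⟨?_, ?_⟩⟩
    · refine Metric.mem_thickening_iff.2 ⟨_, left_mem_segment ℝ _ _, ?_⟩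
      rw [hray, dist_self_add_left]
      exact hηe η h0.le h1
    · simp only [mem_ofPred_eq, add_assoc, hcross, cross2_add_right, cross2_smul_right, cross2_self]
      have := mul_pos h0 hde
      linarith
  have hdisj := hA t htpos htt₀ S hSc hSR hSray hnear
  have hrf : segment ℝ r (r + f) ⊆ P.boundary := by
    have := C'.segment_subset_boundary
    rwa [hC'u] at this
  obtain ⟨hedge, hcomp⟩ := hcor.disjoint_component hcI hu hrf hde hdf hT hω hin htpos htn hSc
    (fun q hq => ⟨hSR hq, hdisj.notMem_of_mem_left hq⟩) hnear
  have hCS : C.seg ⊆ S := subset_union_left.trans subset_union_left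
  rw [← hC'seg] at hdisj hedge hcomp
  rw [← hC'u] at hcomp
  refine hC (C.redundant_of_connected C' hxK (fun q hq => ⟨hxr hq, fun hqC => hno q hqC ?_⟩)
    (hdisj.mono_left hCS) (hcomp.mono_left hCS) (fun q hq => ⟨boundary_subset_region
      (C'.segment_subset_boundary hq), fun hqC => ?_⟩) ?_)
  · exact ((convex_segment _ _).segment_subset (left_mem_segment ℝ _ _) hq).trans hxr
  · have hC'v : C'.v = r := rfl
    rw [hC'v, hC'u, segment_add_eq_image] at hq
    obtain ⟨s, ⟨h0, h1⟩, rfl⟩ := hq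
    rcases h0.eq_or_lt with rfl | h0
    · refine hdisj.notMem_of_mem_left (hCS hqC) ?_
      beta_reduce
      rw [hC'seg, zero_smul, add_zero]
      exact left_mem_segment ℝ _ _
    · refine hcomp.notMem_of_mem_left (hCS hqC) ?_
      rw [hC'u]
      exact hedge s h0 h1
  · have := hedge 1 one_pos le_rfl
    rwa [one_smul, ← hC'u] at this
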